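/- arXiv:math/0610887 — 5 statements merged into one kernel-verified Lean document; each statement's English description precedes it below -/
import Mathlib

section
/- There exists a bounded sequence α of positive real numbers such that the unilateral weighted shift W_α on ℓ²(ℕ, ℂ) is quartically hyponormal (i.e., weakly 4-hyponormal) but not 3-hyponormal. -/
open scoped ComplexOrder
open ContinuousLinearMap

noncomputable section

variable {E : Type*} [NormedAddCommGroup E] [InnerProductSpace ℂ E] [CompleteSpace E]

/-- `T` is hyponormal: `‖T* x‖ ≤ ‖T x‖` for all `x`. -/
def Hyponormal (T : E →L[ℂ] E) : Prop :=
  ∀ x : E, ‖adjoint T x‖ ≤ ‖T x‖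

/-- `T` is `k`-hyponormal: `∑_{i,j=1}^k ⟨(T*^j T^i − T^i T*^j) x_j, x_i⟩ ≥ 0`. -/
def KHyponormal (k : ℕ) (T : E →L[ℂ] E) : Prop :=
  ∀ x : Fin k → E,
    (0 : ℂ) ≤ ∑ i, ∑ j,
      (inner ℂ (x i) ((adjoint T ^ (j.1 + 1) * T ^ (i.1 + 1)
        - T ^ (i.1 + 1) * adjoint T ^ (j.1 + 1)) (x j)) : ℂ)

/-- `T` is weakly `k`-hyponormal: every `∑_{j=1}^k λ_j T^j` is hyponormal. -/
def WeaklyKHyponormal (k : ℕ) (T : E →L[ℂ] E) : Prop :=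
  ∀ lam : Fin k → ℂ, Hyponormal (∑ j : Fin k, lam j • T ^ (j.1 + 1))

/-- The Hilbert space `ℓ²(ℕ, ℂ)`. -/
abbrev H : Type := lp (fun _ : ℕ => ℂ) 2

/-- The canonical orthonormal basis vectors of `ℓ²(ℕ, ℂ)`. -/
def e (n : ℕ) : H := lp.single 2 n 1

/-- `W` is the unilateral weighted shift with weight sequence `α`. -/
def IsWeightedShift (α : ℕ → ℝ) (W : H →L[ℂ] H) : Prop :=
  ∀ n : ℕ, W (e n) = (α n : ℂ) • e (n + 1)

namespace WeightedShift

open ComplexConjugate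

/-- The coordinates of `x` with respect to the orthogonal system `√(γ n) • e n`,
extended by zero to the negative integers. -/
def coeff (γ : ℤ → ℝ) (x : H) : ℤ → ℂ
  | Int.ofNat n => x n / (√(γ n) : ℝ)
  | Int.negSucc _ => 0

lemma coeff_natCast (γ : ℤ → ℝ) (x : H) (n : ℕ) :
    coeff γ x n = x n / (√(γ n) : ℝ) := rfl

lemma coeff_of_neg (γ : ℤ → ℝ) (x : H) {n : ℤ} (hn : n < 0) : coeff γ x n = 0 := by
  obtain ⟨k, rfl⟩ := Int.eq_negSucc_of_lt_zero hn
  rfl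

lemma apply_eq_coeff {γ : ℤ → ℝ} (hγ : ∀ n, 0 < γ n) (x : H) (n : ℕ) :
    x n = (√(γ n) : ℝ) * coeff γ x n := by
  have : ((√(γ n) : ℝ) : ℂ) ≠ 0 := by exact_mod_cast (Real.sqrt_pos.2 (hγ n)).ne'
  rw [coeff_natCast]
  field_simp

/-- Right shift of a sequence, weighted by `α`. -/
def shiftSeq (α : ℕ → ℝ) (x : ℕ → ℂ) : ℕ → ℂ
  | 0 => 0
  | n + 1 => α n * x n

lemma hasSum_norm_sq (x : H) : HasSum (fun n => ‖x n‖ ^ 2) (‖x‖ ^ 2) := by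
  have := lp.hasSum_norm (p := 2) (by norm_num) x
  simpa using this

lemma norm_shiftSeq_sq_le {α : ℕ → ℝ} {C : ℝ} (h₀ : ∀ n, 0 < α n) (hC : ∀ n, α n ≤ C)
    (x : ℕ → ℂ) (n : ℕ) : ‖shiftSeq α x (n + 1)‖ ^ 2 ≤ C ^ 2 * ‖x n‖ ^ 2 := by
  have h1 := h₀ n
  have h2 := hC n
  rw [shiftSeq, norm_mul, Complex.norm_real, Real.norm_of_nonneg h1.le, mul_pow]
  gcongr

lemma summable_shiftSeq {α : ℕ → ℝ} {C : ℝ} (h₀ : ∀ n, 0 < α n) (hC : ∀ n, α n ≤ C) (x : H) :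
    Summable fun n => ‖shiftSeq α x n‖ ^ 2 := by
  rw [← summable_nat_add_iff 1]
  exact .of_nonneg_of_le (fun _ => by positivity) (norm_shiftSeq_sq_le h₀ hC x)
    ((hasSum_norm_sq x).summable.mul_left _)

lemma exists_weightedShift {α : ℕ → ℝ} {C : ℝ} (h₀ : ∀ n, 0 < α n) (hC : ∀ n, α n ≤ C) :
    ∃ W : H →L[ℂ] H, ∀ x n, W x n = shiftSeq α x n := by
  let L : H →ₗ[ℂ] H :=
    { toFun := fun x => ⟨shiftSeq α x, memℓp_gen (by simpa using summable_shiftSeq h₀ hC x)⟩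
      map_add' := by
        intro x y
        ext n
        change shiftSeq α (x + y : H) n = shiftSeq α x n + shiftSeq α y n
        cases n <;> simp [shiftSeq, mul_add]
      map_smul' := by
        intro c x
        ext n
        change shiftSeq α (c • x : H) n = c * shiftSeq α x n
        cases n <;> simp [shiftSeq, mul_left_comm] }
  have hL : ∀ x n, L x n = shiftSeq α x n := fun _ _ => rfl
  have hC0 : 0 ≤ C := (h₀ 0).le.trans (hC 0)
  refine ⟨L.mkContinuous C fun x => ?_, fun x n => hL x n⟩
  refine abs_le_of_sq_le_sq' ?_ (by positivity) |>.2
  rw [mul_pow]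
  refine hasSum_le_of_sum_le (hasSum_norm_sq (L x)) fun s => ?_
  have h1 : HasSum (fun n => C ^ 2 * ‖x n‖ ^ 2) (C ^ 2 * ‖x‖ ^ 2) :=
    (hasSum_norm_sq x).mul_left _
  have hs := summable_shiftSeq h₀ hC x
  calc ∑ i ∈ s, ‖L x i‖ ^ 2 ≤ ∑' n, ‖shiftSeq α x n‖ ^ 2 :=
        hs.sum_le_tsum s fun _ _ => by positivity
    _ = ∑' n, ‖shiftSeq α x (n + 1)‖ ^ 2 := by
        rw [hs.tsum_eq_zero_add]; simp [shiftSeq]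
    _ ≤ C ^ 2 * ‖x‖ ^ 2 :=
        hasSum_le (norm_shiftSeq_sq_le h₀ hC x)
          ((summable_nat_add_iff 1).2 hs).hasSum h1

lemma e_apply (n m : ℕ) : e n m = if m = n then 1 else 0 := by
  simp [e, lp.single_apply, Pi.single_apply]

lemma inner_e (n : ℕ) (x : H) : inner ℂ (e n) x = x n := by
  rw [e, lp.inner_single_left]
  simp

lemma isWeightedShift_of_apply {α : ℕ → ℝ} {W : H →L[ℂ] H}
    (hW : ∀ x n, W x n = shiftSeq α x n) : IsWeightedShift α W := by
  intro n
  ext m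
  rw [hW]
  change _ = (α n : ℂ) * e (n + 1) m
  cases m with
  | zero => simp [shiftSeq, e_apply]
  | succ m => by_cases h : m = n <;> simp [shiftSeq, e_apply, h]

/-- The weights `√(γ (n + 1) / γ n)` of the shift with moments `γ`. -/
def weight (γ : ℤ → ℝ) (n : ℕ) : ℝ := √(γ (n + 1) / γ n)

section moments

variable {γ : ℤ → ℝ} {W : H →L[ℂ] H}

lemma coeff_smul (c : ℂ) (x : H) (n : ℤ) : coeff γ (c • x) n = c * coeff γ x n := by
  cases n <;> simp [coeff, mul_div_assoc]

lemma coeff_shift (hγ : ∀ n, 0 < γ n) (hW : ∀ x n, W x n = shiftSeq (weight γ) x n)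
    (x : H) (n : ℤ) : coeff γ (W x) n = coeff γ x (n - 1) := by
  rcases lt_or_ge n 0 with hn | hn
  · rw [coeff_of_neg _ _ hn, coeff_of_neg _ _ (by omega)]
  obtain ⟨n, rfl⟩ := Int.eq_ofNat_of_zero_le hn
  cases n with
  | zero =>
    rw [coeff_natCast, hW, coeff_of_neg _ _ (by simp)]
    simp [shiftSeq]
  | succ n =>
    have h1 : ((√(γ n) : ℝ) : ℂ) ≠ 0 := by exact_mod_cast (Real.sqrt_pos.2 (hγ n)).ne'
    have h2 : ((√(γ (n + 1)) : ℝ) : ℂ) ≠ 0 := by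
      exact_mod_cast (Real.sqrt_pos.2 (hγ (n + 1))).ne'
    rw [coeff_natCast, hW, show ((n + 1 : ℕ) : ℤ) - 1 = n by simp, coeff_natCast, shiftSeq, weight,
      Real.sqrt_div (hγ _).le]
    push_cast
    field_simp

lemma coeff_pow (hγ : ∀ n, 0 < γ n) (hW : ∀ x n, W x n = shiftSeq (weight γ) x n)
    (x : H) (k : ℕ) (n : ℤ) : coeff γ ((W ^ k) x) n = coeff γ x (n - k) := by
  induction k generalizing n with
  | zero => simp
  | succ k ih =>
    rw [pow_succ', mul_apply_eq_comp, coeff_shift hγ hW, ih]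
    congr 1
    push_cast
    ring

lemma pow_e (hγ : ∀ n, 0 < γ n) (hW : ∀ x n, W x n = shiftSeq (weight γ) x n) (k n : ℕ) :
    (W ^ k) (e n) = ((√(γ (n + k)) / √(γ n) : ℝ) : ℂ) • e (n + k) := by
  induction k with
  | zero => simp [(Real.sqrt_pos.2 (hγ n)).ne']
  | succ k ih =>
    have h1 : ((√(γ (n + k)) : ℝ) : ℂ) ≠ 0 := by
      exact_mod_cast (Real.sqrt_pos.2 (hγ (n + k))).ne'
    rw [pow_succ', mul_apply_eq_comp, ih, map_smul, isWeightedShift_of_apply hW (n + k),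
      smul_smul, weight, Real.sqrt_div (hγ _).le]
    push_cast
    rw [← add_assoc, ← add_assoc]
    congr 1
    field_simp

lemma hasSum_re_inner (hγ : ∀ n, 0 < γ n) (x y : H) :
    HasSum (fun n : ℤ => γ n * (conj (coeff γ x n) * coeff γ y n).re) (inner ℂ x y).re := by
  have h := Complex.hasSum_re (lp.hasSum_inner (𝕜 := ℂ) x y)
  rw [← Function.Injective.hasSum_iff Nat.cast_injective (g := fun n : ℕ => (n : ℤ))]
  · convert h using 2 with n
    rw [RCLike.inner_apply', apply_eq_coeff hγ x n, apply_eq_coeff hγ y n]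
    simp only [Function.comp_apply, map_mul, Complex.conj_ofReal]
    rw [show ∀ s a b : ℂ, s * a * (s * b) = (s * s) * (a * b) by intros; ring,
      ← Complex.ofReal_mul, Real.mul_self_sqrt (hγ _).le, Complex.re_ofReal_mul]
  · intro n hn
    rw [coeff_of_neg γ x]
    · simp
    · by_contra! h0
      exact hn ⟨n.toNat, Int.toNat_of_nonneg h0⟩

/-- The coordinates contributing to the `m`-th diagonal of the self-commutator
of `∑ j, lam j • W ^ (j + 1)` at `x`. -/
def diag (γ : ℤ → ℝ) {k : ℕ} (lam : Fin k → ℂ) (x : H) (m : ℤ) (i : Fin k) : ℂ :=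
  conj (lam i) * coeff γ x (m + (i.1 + 1))

lemma hasSum_norm_sq_apply (hγ : ∀ n, 0 < γ n) (hW : ∀ x n, W x n = shiftSeq (weight γ) x n)
    {k : ℕ} (lam : Fin k → ℂ) (x : H) :
    HasSum (fun m : ℤ => ∑ i, ∑ j, γ (m + (i.1 + 1) + (j.1 + 1)) *
        (conj (diag γ lam x m i) * diag γ lam x m j).re)
      (‖(∑ j : Fin k, lam j • W ^ (j.1 + 1)) x‖ ^ 2) := by
  have h1 : ‖(∑ j : Fin k, lam j • W ^ (j.1 + 1)) x‖ ^ 2 =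
      ∑ i : Fin k, ∑ j : Fin k,
        (inner ℂ (lam j • (W ^ (j.1 + 1)) x) (lam i • (W ^ (i.1 + 1)) x)).re := by
    rw [← inner_self_eq_norm_sq (𝕜 := ℂ)]
    simp only [_root_.sum_apply, _root_.smul_apply]
    rw [sum_inner, Finset.sum_congr rfl fun _ _ => inner_sum _ _ _, Finset.sum_comm]
    simp only [map_sum, RCLike.re_to_complex]
  rw [h1]
  refine hasSum_sum fun i _ => hasSum_sum fun j _ => ?_
  have h2 := hasSum_re_inner hγ (lam j • (W ^ (j.1 + 1)) x) (lam i • (W ^ (i.1 + 1)) x)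
  rw [← (Equiv.addRight ((i.1 + 1 : ℤ) + (j.1 + 1))).hasSum_iff] at h2
  convert h2 using 2 with m
  simp only [Function.comp_apply, Equiv.coe_addRight, coeff_smul, coeff_pow hγ hW, diag, map_mul,
    Complex.conj_conj]
  push_cast
  rw [show m + ((i.1 + 1 : ℤ) + (j.1 + 1)) - (j.1 + 1) = m + (i.1 + 1) by ring,
    show m + ((i.1 + 1 : ℤ) + (j.1 + 1)) - (i.1 + 1) = m + (j.1 + 1) by ring, ← add_assoc]
  congr 2 <;> ring

lemma adjoint_apply (hγ : ∀ n, 0 < γ n) (hW : ∀ x n, W x n = shiftSeq (weight γ) x n)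
    {k : ℕ} (lam : Fin k → ℂ) (x : H) (n : ℕ) :
    adjoint (∑ j : Fin k, lam j • W ^ (j.1 + 1)) x n =
      (∑ i, γ (n + (i.1 + 1)) * diag γ lam x n i) / (√(γ n) : ℝ) := by
  rw [← inner_e, adjoint_inner_right]
  simp only [_root_.sum_apply, _root_.smul_apply, sum_inner, inner_smul_left, pow_e hγ hW, inner_e,
    Complex.conj_ofReal, Finset.sum_div]
  refine Finset.sum_congr rfl fun i _ => ?_
  rw [apply_eq_coeff hγ, diag]
  have h : ((√(γ (n + (i.1 + 1))) : ℝ) : ℂ) * (√(γ (n + (i.1 + 1))) : ℝ) =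
      (γ (n + (i.1 + 1)) : ℝ) := by
    rw [← Complex.ofReal_mul, Real.mul_self_sqrt (hγ _).le]
  push_cast
  linear_combination
    conj (lam i) * coeff γ x (n + (i.1 + 1)) / ((√(γ n) : ℝ) : ℂ) * h

lemma hasSum_norm_sq_adjoint_apply (hγ : ∀ n, 0 < γ n)
    (hW : ∀ x n, W x n = shiftSeq (weight γ) x n) {k : ℕ} (lam : Fin k → ℂ) (x : H) :
    HasSum (fun m : ℤ => if 0 ≤ m then
        ‖∑ i, γ (m + (i.1 + 1)) * diag γ lam x m i‖ ^ 2 / γ m else 0)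
      (‖adjoint (∑ j : Fin k, lam j • W ^ (j.1 + 1)) x‖ ^ 2) := by
  rw [← Function.Injective.hasSum_iff Nat.cast_injective (g := fun n : ℕ => (n : ℤ))]
  · convert hasSum_norm_sq (adjoint (∑ j : Fin k, lam j • W ^ (j.1 + 1)) x) using 2 with n
    simp only [Function.comp_apply, Int.natCast_nonneg, if_true]
    rw [adjoint_apply hγ hW, norm_div, div_pow, Complex.norm_real, Real.norm_eq_abs, sq_abs,
      Real.sq_sqrt (hγ _).le]
  · intro n hn
    refine if_neg fun h0 => hn ⟨n.toNat, Int.toNat_of_nonneg h0⟩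

/-- The sesquilinear form of `KHyponormal` at a family `c i • e (i + 1)`. -/
lemma re_form_e (hγ : ∀ n, 0 < γ n) (hW : ∀ x n, W x n = shiftSeq (weight γ) x n)
    {k : ℕ} (c : Fin k → ℝ) (h : KHyponormal k W) :
    0 ≤ ∑ i, ∑ j, c i * c j *
      (γ (i.1 + 1 + (j.1 + 1)) - γ (i.1 + 1) * γ (j.1 + 1) / γ 0) := by
  have hadj : ∀ i : ℕ, adjoint (W ^ i) (e i) = ((√(γ i) / √(γ 0) : ℝ) : ℂ) • e 0 := by
    intro i
    ext m
    rw [← inner_e, adjoint_inner_right, pow_e hγ hW, inner_smul_left, inner_e]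
    simp only [e_apply, Complex.conj_ofReal]
    by_cases hm : m = 0 <;> simp [hm, e_apply]
  have h := h fun i => ((c i * √(γ (i.1 + 1)) : ℝ) : ℂ) • e (i.1 + 1)
  rw [← Complex.zero_le_real]
  convert h using 1
  rw [Complex.ofReal_sum]
  refine Finset.sum_congr rfl fun i _ => ?_
  rw [Complex.ofReal_sum]
  refine Finset.sum_congr rfl fun j _ => ?_
  have hpow : ∀ n : ℕ, adjoint W ^ n = adjoint (W ^ n) := fun n => (star_pow W n).symm
  rw [_root_.sub_apply, mul_apply_eq_comp, mul_apply_eq_comp, inner_sub_right, hpow,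
    adjoint_inner_right, ← adjoint_inner_left (W ^ (i.1 + 1)) (adjoint (W ^ (j.1 + 1)) _)]
  simp only [map_smul, pow_e hγ hW, hadj, inner_smul_left, inner_smul_right, inner_e, e_apply,
    add_comm (j.1 + 1) (i.1 + 1), if_true, mul_one, Complex.conj_ofReal, ← Complex.ofReal_mul,
    ← Complex.ofReal_sub]
  congr 1
  rw [add_comm ((j.1 + 1 : ℕ) : ℤ)]
  push_cast
  have hi := (Real.sqrt_pos.2 (hγ (i.1 + 1))).ne'
  have hj := (Real.sqrt_pos.2 (hγ (j.1 + 1))).ne'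
  have h0 := (Real.sqrt_pos.2 (hγ 0)).ne'
  conv_lhs => rw [← Real.mul_self_sqrt (hγ (i.1 + 1 + (j.1 + 1))).le,
    ← Real.mul_self_sqrt (hγ (i.1 + 1)).le, ← Real.mul_self_sqrt (hγ (j.1 + 1)).le,
    ← Real.mul_self_sqrt (hγ 0).le]
  field_simp

end moments

/-- The atoms of the measure whose moments of positive order are those of the example. -/
def atom : Fin 5 → ℝ := ![1, 5, 10, 16, 20]

/-- The masses of the atoms. -/
def mass : Fin 5 → ℝ := ![256, 64, 16, 8, 1]

/-- The `n`-th moment of the atomic measure. -/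
def moment (n : ℤ) : ℝ := ∑ k, mass k * atom k ^ n

/-- The moments of the example: those of the measure, except for the one of order `0`,
which is lowered from `345` to `275`. -/
def gam (n : ℤ) : ℝ := if n = 0 then 275 else moment n

lemma atom_pos (k : Fin 5) : 0 < atom k := by fin_cases k <;> norm_num [atom]

lemma mass_pos (k : Fin 5) : 0 < mass k := by fin_cases k <;> norm_num [mass]

lemma moment_pos (n : ℤ) : 0 < moment n :=
  Finset.sum_pos (fun k _ => mul_pos (mass_pos k) (zpow_pos (atom_pos k) n)) Finset.univ_nonempty

lemma gam_pos (n : ℤ) : 0 < gam n := by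
  unfold gam
  split_ifs
  · norm_num
  · exact moment_pos n

lemma gam_of_ne {n : ℤ} (hn : n ≠ 0) : gam n = moment n := if_neg hn

lemma moment_succ_le (n : ℤ) : moment (n + 1) ≤ 20 * moment n := by
  rw [moment, moment, Finset.mul_sum]
  refine Finset.sum_le_sum fun k _ => ?_
  have h1 : atom k ≤ 20 := by fin_cases k <;> norm_num [atom]
  have h2 := mul_pos (mass_pos k) (zpow_pos (atom_pos k) n)
  rw [zpow_add_one₀ (atom_pos k).ne']
  nlinarith

lemma gam_succ_le (n : ℕ) : gam (n + 1) ≤ 20 * gam n := by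
  rw [gam_of_ne (by omega)]
  rcases eq_or_ne n 0 with rfl | hn
  · simp [gam, moment, Fin.sum_univ_five, atom, mass]
    norm_num
  · rw [gam_of_ne (by omega)]
    exact moment_succ_le n

lemma weight_gam_le (n : ℕ) : weight gam n ≤ 5 := by
  rw [weight, Real.sqrt_le_left (by norm_num), div_le_iff₀ (gam_pos _)]
  have := gam_succ_le n
  have := gam_pos n
  linarith

lemma weight_gam_pos (n : ℕ) : 0 < weight gam n :=
  Real.sqrt_pos.2 (div_pos (gam_pos _) (gam_pos _))

/-- The value at the `k`-th atom of the polynomial `∑ i, v i * t ^ (i + 1)`. -/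
def evalAtom (v : Fin 4 → ℂ) (k : Fin 5) : ℂ := ∑ i, v i * (atom k : ℂ) ^ (i.1 + 1)

/-- Diagonal terms of `‖p(W) x‖²` in terms of the measure. -/
def formTerm (v : Fin 4 → ℂ) (m : ℤ) : ℝ := ∑ k, mass k * atom k ^ m * ‖evalAtom v k‖ ^ 2

/-- Diagonal terms of `p(W)* x` in terms of the measure. -/
def functionalTerm (v : Fin 4 → ℂ) (m : ℤ) : ℂ :=
  ∑ k, ((mass k * atom k ^ m : ℝ) : ℂ) * evalAtom v k

lemma formTerm_nonneg (v : Fin 4 → ℂ) (m : ℤ) : 0 ≤ formTerm v m :=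
  Finset.sum_nonneg fun k _ =>
    mul_nonneg (mul_pos (mass_pos k) (zpow_pos (atom_pos k) m)).le (by positivity)

lemma norm_functionalTerm_sq_le (v : Fin 4 → ℂ) (m : ℤ) :
    ‖functionalTerm v m‖ ^ 2 ≤ moment m * formTerm v m := by
  have hw : ∀ k, 0 ≤ mass k * atom k ^ m := fun k =>
    (mul_pos (mass_pos k) (zpow_pos (atom_pos k) m)).le
  have h1 : ‖functionalTerm v m‖ ≤ ∑ k, mass k * atom k ^ m * ‖evalAtom v k‖ := by
    refine (norm_sum_le _ _).trans_eq (Finset.sum_congr rfl fun k _ => ?_)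
    rw [norm_mul, Complex.norm_real, Real.norm_of_nonneg (hw k)]
  refine (pow_le_pow_left₀ (norm_nonneg _) h1 2).trans ?_
  refine Finset.sum_sq_le_sum_mul_sum_of_sq_le_mul _ (fun k _ => hw k)
    (fun k _ => mul_nonneg (hw k) (by positivity)) fun k _ => le_of_eq ?_
  ring

lemma sum_gam_mul_eq_functionalTerm (v : Fin 4 → ℂ) {m : ℤ} (hm : 0 ≤ m) :
    ∑ i : Fin 4, (gam (m + (i.1 + 1)) : ℂ) * v i = functionalTerm v m := by
  simp only [functionalTerm, evalAtom, Finset.mul_sum]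
  rw [Finset.sum_comm]
  refine Finset.sum_congr rfl fun i _ => ?_
  rw [gam_of_ne (by omega), moment, Complex.ofReal_sum, Finset.sum_mul]
  refine Finset.sum_congr rfl fun k _ => ?_
  have : atom k ^ (m + (i.1 + 1)) = atom k ^ m * atom k ^ (i.1 + 1) := by
    rw [zpow_add₀ (atom_pos k).ne']
    norm_cast
  rw [this]
  push_cast
  ring

lemma sum_gam_mul_eq_formTerm (v : Fin 4 → ℂ) {m : ℤ}
    (hv : ∀ i : Fin 4, m + (i.1 + 1) < 0 → v i = 0) :
    ∑ i : Fin 4, ∑ j : Fin 4, gam (m + (i.1 + 1) + (j.1 + 1)) * (conj (v i) * v j).re =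
      formTerm v m := by
  have h1 : ∀ k, ‖evalAtom v k‖ ^ 2 =
      ∑ i : Fin 4, ∑ j : Fin 4, atom k ^ (i.1 + 1) * atom k ^ (j.1 + 1) * (conj (v i) * v j).re := by
    intro k
    have : ((‖evalAtom v k‖ ^ 2 : ℝ) : ℂ) = conj (evalAtom v k) * evalAtom v k := by
      rw [mul_comm, Complex.mul_conj, Complex.normSq_eq_norm_sq]
    rw [← Complex.ofReal_re (‖evalAtom v k‖ ^ 2), this, evalAtom, map_sum, Finset.sum_mul_sum,
      Complex.re_sum]
    refine Finset.sum_congr rfl fun i _ => ?_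
    rw [Complex.re_sum]
    refine Finset.sum_congr rfl fun j _ => ?_
    rw [← Complex.re_ofReal_mul]
    congr 1
    simp only [map_mul, map_pow, Complex.conj_ofReal]
    push_cast
    ring
  simp only [formTerm, h1, Finset.mul_sum]
  rw [Finset.sum_comm]
  conv_rhs =>
    rw [Finset.sum_comm]
    enter [2, i]
    rw [Finset.sum_comm]
  rw [Finset.sum_comm]
  refine Finset.sum_congr rfl fun i _ => Finset.sum_congr rfl fun j _ => ?_
  by_cases hi : m + (i.1 + 1) < 0
  · simp [hv i hi]
  rw [gam_of_ne (by omega), moment, Finset.sum_mul]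
  refine Finset.sum_congr rfl fun k _ => ?_
  have : atom k ^ (m + (i.1 + 1) + (j.1 + 1)) =
      atom k ^ m * atom k ^ (i.1 + 1) * atom k ^ (j.1 + 1) := by
    rw [zpow_add₀ (atom_pos k).ne', zpow_add₀ (atom_pos k).ne']
    norm_cast
  rw [this]
  ring

/-- Coercivity of the form of order `-1` in the second coordinate. -/
lemma quad_neg_one (a b c d : ℝ) :
    400 * b ^ 2 ≤ 256 * (a + b + c + d) ^ 2 +
      64 * 5⁻¹ * (5 * a + 25 * b + 125 * c + 625 * d) ^ 2 +
      16 * 10⁻¹ * (10 * a + 100 * b + 1000 * c + 10000 * d) ^ 2 +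
      8 * 16⁻¹ * (16 * a + 256 * b + 4096 * c + 65536 * d) ^ 2 +
      20⁻¹ * (20 * a + 400 * b + 8000 * c + 160000 * d) ^ 2 := by
  rw [← sub_nonneg]
  have h : 0 ≤ 4/221 * (221 * a + 1476 * b + 16256 * c + 221136 * d) ^ 2 +
      400/3076099 * (13919 * b + 248772 * c + 4133380 * d) ^ 2 +
      1600/7512627141 * (1619217 * c + 47681741 * d) ^ 2 +
      844255628800/539739 * d ^ 2 := by positivity
  refine h.trans_eq ?_
  ring

/-- Coercivity of the form of order `1` in the first coordinate. -/
lemma quad_one (a b c d : ℝ) :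
    64 * a ^ 2 ≤ 256 * (a + b + c + d) ^ 2 +
      64 * 5 * (5 * a + 25 * b + 125 * c + 625 * d) ^ 2 +
      16 * 10 * (10 * a + 100 * b + 1000 * c + 10000 * d) ^ 2 +
      8 * 16 * (16 * a + 256 * b + 4096 * c + 65536 * d) ^ 2 +
      20 * (20 * a + 400 * b + 8000 * c + 160000 * d) ^ 2 -
      (5904 * a + 65024 * b + 884544 * c + 13388864 * d) ^ 2 / 884 := by
  rw [← sub_nonneg]
  have h : 0 ≤ 32/9741017 * (88154 * a + 1554825 * b + 25833625 * c + 434393925 * d) ^ 2 +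
      800/179251153521 * (12200319 * b + 334305911 * c + 7141980123 * d) ^ 2 +
      64000/4192711537096959 * (1030967683 * c + 42362795853 * d) ^ 2 +
      170639933879808000/1030967683 * d ^ 2 := by positivity
  refine h.trans_eq ?_
  ring

/-- Lower bound for the form of order `0`. -/
lemma quad_zero (a b c d : ℝ) :
    320 * (a * b) ≤ 256 * (a + b + c + d) ^ 2 +
      64 * (5 * a + 25 * b + 125 * c + 625 * d) ^ 2 +
      16 * (10 * a + 100 * b + 1000 * c + 10000 * d) ^ 2 +
      8 * (16 * a + 256 * b + 4096 * c + 65536 * d) ^ 2 +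
      (20 * a + 400 * b + 8000 * c + 160000 * d) ^ 2 -
      (884 * a + 5904 * b + 65024 * c + 884544 * d) ^ 2 / 275 := by
  rw [← sub_nonneg]
  have h : 0 ≤ 32/7237175 * (26317 * a + 394327 * b + 5805262 * c + 90625022 * d) ^ 2 +
      160/304117646663 * (11555939 * b + 307748212 * c + 6286025212 * d) ^ 2 +
      320/418282025536088771 * (36196281889 * c + 1420709871469 * d) ^ 2 +
      3341347217597772800/36196281889 * d ^ 2 := by positivity
  refine h.trans_eq ?_
  ring

lemma re_evalAtom (v : Fin 4 → ℂ) (k : Fin 5) :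
    (evalAtom v k).re = atom k * (v 0).re + atom k ^ 2 * (v 1).re + atom k ^ 3 * (v 2).re +
      atom k ^ 4 * (v 3).re := by
  simp only [evalAtom, Fin.sum_univ_four, ← Complex.ofReal_pow, mul_comm (v _),
    Complex.re_ofReal_mul, Complex.add_re]
  simp

lemma im_evalAtom (v : Fin 4 → ℂ) (k : Fin 5) :
    (evalAtom v k).im = atom k * (v 0).im + atom k ^ 2 * (v 1).im + atom k ^ 3 * (v 2).im +
      atom k ^ 4 * (v 3).im := by
  simp only [evalAtom, Fin.sum_univ_four, ← Complex.ofReal_pow, mul_comm (v _),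
    Complex.im_ofReal_mul, Complex.add_im]
  simp

lemma formTerm_eq (v : Fin 4 → ℂ) (m : ℤ) :
    formTerm v m = ∑ k, mass k * atom k ^ m * (evalAtom v k).re ^ 2 +
      ∑ k, mass k * atom k ^ m * (evalAtom v k).im ^ 2 := by
  rw [formTerm, ← Finset.sum_add_distrib]
  refine Finset.sum_congr rfl fun k _ => ?_
  rw [Complex.sq_norm, Complex.normSq_apply]
  ring

lemma norm_functionalTerm_sq (v : Fin 4 → ℂ) (m : ℤ) :
    ‖functionalTerm v m‖ ^ 2 = (∑ k, mass k * atom k ^ m * (evalAtom v k).re) ^ 2 +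
      (∑ k, mass k * atom k ^ m * (evalAtom v k).im) ^ 2 := by
  rw [Complex.sq_norm, Complex.normSq_apply, functionalTerm, Complex.re_sum, Complex.im_sum]
  simp only [Complex.re_ofReal_mul, Complex.im_ofReal_mul]
  ring

lemma le_formTerm_neg_one (v : Fin 4 → ℂ) : 400 * ‖v 1‖ ^ 2 ≤ formTerm v (-1) := by
  rw [formTerm_eq, Complex.sq_norm, Complex.normSq_apply]
  have h1 := quad_neg_one (v 0).re (v 1).re (v 2).re (v 3).re
  have h2 := quad_neg_one (v 0).im (v 1).im (v 2).im (v 3).im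
  simp only [Fin.sum_univ_five, re_evalAtom, im_evalAtom, atom, mass, zpow_neg_one]
  simp [-one_div]
  norm_num1 at h1 h2 ⊢
  linarith

lemma le_formTerm_one (v : Fin 4 → ℂ) :
    64 * ‖v 0‖ ^ 2 ≤ formTerm v 1 - ‖functionalTerm v 1‖ ^ 2 / gam 1 := by
  rw [formTerm_eq, norm_functionalTerm_sq, Complex.sq_norm, Complex.normSq_apply]
  have h1 := quad_one (v 0).re (v 1).re (v 2).re (v 3).re
  have h2 := quad_one (v 0).im (v 1).im (v 2).im (v 3).im
  have hg : gam 1 = 884 := by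
    simp [gam, moment, Fin.sum_univ_five, atom, mass]
    norm_num
  rw [hg]
  simp only [Fin.sum_univ_five, re_evalAtom, im_evalAtom, atom, mass, zpow_one]
  simp
  norm_num1 at h1 h2 ⊢
  linarith

lemma le_formTerm_zero (v : Fin 4 → ℂ) :
    320 * (conj (v 0) * v 1).re ≤ formTerm v 0 - ‖functionalTerm v 0‖ ^ 2 / gam 0 := by
  rw [formTerm_eq, norm_functionalTerm_sq]
  have h1 := quad_zero (v 0).re (v 1).re (v 2).re (v 3).re
  have h2 := quad_zero (v 0).im (v 1).im (v 2).im (v 3).im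
  have hg : gam 0 = 275 := if_pos rfl
  rw [hg]
  simp only [Fin.sum_univ_five, re_evalAtom, im_evalAtom, atom, mass, zpow_zero]
  simp
  norm_num1 at h1 h2 ⊢
  linarith

/-- Nonnegativity of the three diagonals meeting the lowered moment. -/
lemma three_diagonals_nonneg (lam : Fin 4 → ℂ) (y : ℤ → ℂ) {v : ℤ → Fin 4 → ℂ}
    (hv : ∀ m i, v m i = lam i * y (m + (i.1 + 1))) :
    0 ≤ formTerm (v (-1)) (-1) + (formTerm (v 0) 0 - ‖functionalTerm (v 0) 0‖ ^ 2 / gam 0) +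
      (formTerm (v 1) 1 - ‖functionalTerm (v 1) 1‖ ^ 2 / gam 1) := by
  have h1 := le_formTerm_neg_one (v (-1))
  have h2 := le_formTerm_zero (v 0)
  have h3 := le_formTerm_one (v 1)
  have h4 : -(‖v 1 0‖ * ‖v (-1) 1‖) ≤ (conj (v 0 0) * v 0 1).re := by
    have : ‖v 1 0‖ * ‖v (-1) 1‖ = ‖conj (v 0 0) * v 0 1‖ := by
      rw [norm_mul, RCLike.norm_conj]
      simp only [hv, norm_mul]
      norm_num
      ring
    rw [this]
    exact neg_le_of_abs_le (Complex.abs_re_le_norm _)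
  nlinarith [sq_nonneg (8 * ‖v 1 0‖ - 20 * ‖v (-1) 1‖)]

lemma weaklyKHyponormal_four {W : H →L[ℂ] H} (hW : ∀ x n, W x n = shiftSeq (weight gam) x n) :
    WeaklyKHyponormal 4 W := by
  intro lam x
  refine abs_le_of_sq_le_sq' ?_ (norm_nonneg _) |>.2
  have h1 : ∀ m : ℤ, ∑ i : Fin 4, ∑ j : Fin 4, gam (m + (i.1 + 1) + (j.1 + 1)) *
      (conj (diag gam lam x m i) * diag gam lam x m j).re = formTerm (diag gam lam x m) m :=
    fun m => sum_gam_mul_eq_formTerm _ fun i hi => by rw [diag, coeff_of_neg _ _ hi, mul_zero]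
  have h2 := hasSum_norm_sq_apply gam_pos hW lam x
  rw [funext h1] at h2
  have h := h2.sub (hasSum_norm_sq_adjoint_apply gam_pos hW lam x)
  rw [← sub_nonneg]
  refine le_trans ?_ (sum_le_hasSum {-1, 0, 1} (fun m hm => ?_) h)
  · rw [Finset.sum_insert (by decide), Finset.sum_insert (by decide), Finset.sum_singleton,
      if_neg (by decide), if_pos le_rfl, if_pos zero_le_one, sub_zero, ← add_assoc,
      sum_gam_mul_eq_functionalTerm _ le_rfl, sum_gam_mul_eq_functionalTerm _ zero_le_one]
    exact three_diagonals_nonneg _ _ fun _ _ => rfl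
  · split_ifs with h0
    · have hm0 : m ≠ 0 := fun h => by simp [h] at hm
      rw [sum_gam_mul_eq_functionalTerm _ h0, sub_nonneg, div_le_iff₀ (gam_pos m), gam_of_ne hm0,
        mul_comm]
      exact norm_functionalTerm_sq_le _ _
    · rw [sub_zero]
      exact formTerm_nonneg _ _

lemma not_kHyponormal_three {W : H →L[ℂ] H} (hW : ∀ x n, W x n = shiftSeq (weight gam) x n) :
    ¬ KHyponormal 3 W := by
  intro h
  have h1 := re_form_e gam_pos hW ![184, -27, 1] h
  revert h1
  have hm : ∀ n : ℕ, gam (n + 1) = 256 + 64 * 5 ^ (n + 1) + 16 * 10 ^ (n + 1) + 8 * 16 ^ (n + 1)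
      + 20 ^ (n + 1) := by
    intro n
    rw [gam_of_ne (by omega), moment]
    norm_cast
    simp [Fin.sum_univ_five, atom, mass]
  have g1 := hm 0
  have g2 := hm 1
  have g3 := hm 2
  have g4 := hm 3
  have g5 := hm 4
  have g6 := hm 5
  have g0 : gam 0 = 275 := if_pos rfl
  norm_num at g1 g2 g3 g4 g5 g6
  simp [Fin.sum_univ_three]
  norm_num [g0, g1, g2, g3, g4, g5, g6]

end WeightedShift

/-- There exists a bounded sequence of positive weights whose weighted shift is
quartically hyponormal (weakly 4-hyponormal) but not 3-hyponormal. -/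
theorem quartically_hyponormal_not_three_hyponormal :
    ∃ (α : ℕ → ℝ) (W : H →L[ℂ] H),
      (∃ C : ℝ, ∀ n, α n ≤ C) ∧ (∀ n, 0 < α n) ∧
      IsWeightedShift α W ∧
      WeaklyKHyponormal 4 W ∧ ¬ KHyponormal 3 W := by
  obtain ⟨W, hW⟩ := WeightedShift.exists_weightedShift WeightedShift.weight_gam_pos
    WeightedShift.weight_gam_le
  exact ⟨WeightedShift.weight WeightedShift.gam, W, ⟨5, WeightedShift.weight_gam_le⟩,
    WeightedShift.weight_gam_pos, WeightedShift.isWeightedShift_of_apply hW,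
    WeightedShift.weaklyKHyponormal_four hW, WeightedShift.not_kHyponormal_three hW⟩
end
end

section
/- Let T be a bounded linear operator on a complex Hilbert space H such that T + s T² is hyponormal for every real number s ≥ 0, and suppose that for every real θ there exists a unitary operator U on H with U T U* = e^{−iθ} T. Then T + c T² is hyponormal for every complex number c. -/
open scoped ComplexOrder
open ContinuousLinearMap

noncomputable section

variable {E : Type*} [NormedAddCommGroup E] [InnerProductSpace ℂ E] [CompleteSpace E]

theorem Hyponormal.smul {T : E →L[ℂ] E} (hT : Hyponormal T) (a : ℂ) : Hyponormal (a • T) := by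
  intro x
  have hadj : adjoint (a • T) = star a • adjoint T := star_smul a T
  simp only [hadj, _root_.smul_apply, norm_smul, norm_star]
  exact mul_le_mul_of_nonneg_left (hT x) (norm_nonneg a)

theorem Hyponormal.unitary_conj {T U : E →L[ℂ] E} (hT : Hyponormal T)
    (hU : U ∈ unitary (E →L[ℂ] E)) : Hyponormal (U * T * star U) := by
  intro x
  have hadj : adjoint (U * T * star U) = U * adjoint T * star U := by
    simp only [← star_eq_adjoint, star_mul, star_star, mul_assoc]
  have hnorm (y : E) : ‖U y‖ = ‖y‖ := norm_map_of_mem_unitary hU y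
  rw [hadj]
  change ‖U (adjoint T (star U x))‖ ≤ ‖U (T (star U x))‖
  rw [hnorm, hnorm]
  exact hT (star U x)

/-- If `T + s T²` is hyponormal for all `s ≥ 0` and `T` is unitarily equivalent to
each of its rotations `e^{-iθ} T`, then `T + c T²` is hyponormal for all `c ∈ ℂ`. -/
theorem hyponormal_add_smul_sq_of_nonneg {E : Type*} [NormedAddCommGroup E]
    [InnerProductSpace ℂ E] [CompleteSpace E] (T : E →L[ℂ] E)
    (h1 : ∀ s : ℝ, 0 ≤ s → Hyponormal (T + (s : ℂ) • T ^ 2))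
    (h2 : ∀ θ : ℝ, ∃ U : E →L[ℂ] E, U ∈ unitary (E →L[ℂ] E) ∧
      U * T * star U = Complex.exp (-(θ : ℂ) * Complex.I) • T) :
    ∀ c : ℂ, Hyponormal (T + c • T ^ 2) := by
  intro c
  obtain ⟨U, hU, hUT⟩ := h2 (-c.arg)
  set w : ℂ := Complex.exp (-((-c.arg : ℝ) : ℂ) * Complex.I) with hw
  have hw0 : w ≠ 0 := Complex.exp_ne_zero _
  have hc : (‖c‖ : ℂ) * w = c := by
    rw [hw, Complex.ofReal_neg, neg_neg, Complex.norm_mul_exp_arg_mul_I]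
  have hsq : U * T ^ 2 * star U = w ^ 2 • T ^ 2 := by
    calc U * T ^ 2 * star U = U * T * (star U * U) * T * star U := by
          rw [Unitary.star_mul_self_of_mem hU, mul_one, sq, mul_assoc U T T]
      _ = (U * T * star U) * (U * T * star U) := by simp only [mul_assoc]
      _ = w ^ 2 • T ^ 2 := by rw [hUT, ← sq, smul_pow]
  have hconj : T + c • T ^ 2 = w⁻¹ • (U * (T + (‖c‖ : ℂ) • T ^ 2) * star U) := by
    rw [mul_add, add_mul, mul_smul_comm, smul_mul_assoc, hUT, hsq, smul_add, inv_smul_smul₀ hw0,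
      smul_smul, smul_smul]
    congr 2
    refine hc.symm.trans ?_
    field_simp
  rw [hconj]
  exact ((h1 ‖c‖ (norm_nonneg c)).unitary_conj hU).smul w⁻¹
end
end

section
/- Let α = (α_n)_{n≥0} be a bounded sequence of positive real numbers, extended by α_{−1} = α_{−2} = α_{−3} = α_{−4} = 0, and let W_α be the associated unilateral weighted shift on ℓ²(ℕ, ℂ). With the quantities u_i, w_i, v_i, s_i, t_i, p_i, q_i, f_i, g_i, r_i and the matrices Θ₂ and Δ_i (i ≥ 0) defined as follows — u_i := α_i² − α_{i−1}², w_i := α_i²(α_{i+1}² − α_{i−1}²)², v_i := α_i²α_{i+1}² − α_{i−1}²α_{i−2}², s_i := α_i²α_{i+1}²(α_{i+2}² − α_{i−1}²)², t_i := α_i²(α_{i+1}²α_{i+2}² − α_{i−1}²α_{i−2}²)², p_i := α_i²α_{i+1}²α_{i+2}² − α_{i−1}²α_{i−2}²α_{i−3}², q_i := α_i²α_{i+1}²α_{i+2}²(α_{i+3}² − α_{i−1}²)², f_i := α_i²α_{i+1}²(α_{i+2}²α_{i+3}² − α_{i−1}²α_{i−2}²)², g_i := α_i²(α_{i+1}²α_{i+2}²α_{i+3}²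 − α_{i−1}²α_{i−2}²α_{i−3}²)², r_i := α_i²α_{i+1}²α_{i+2}²α_{i+3}² − α_{i−1}²α_{i−2}²α_{i−3}²α_{i−4}²; Θ₂ is the 3×3 matrix with rows (v₀, √t₀, √f₀), (√t₀, p₁, √g₁), (√f₀, √g₁, r₂); and Δ_i is the 4×4 matrix with rows (u_i, √w_i, √s_i, √q_i), (√w_i, v_{i+1}, √t_{i+1}, √f_{i+1}), (√s_i, √t_{i+1}, p_{i+2}, √g_{i+2}), (√q_i, √f_{i+1}, √g_{i+2}, r_{i+3}) — the shift W_α is 4-hyponormal if and only if Θ₂ is positive semidefinite and Δ_i is positive semidefinite for all i ≥ 0. -/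
open scoped ComplexOrder
open ContinuousLinearMap Matrix

noncomputable section

variable {E : Type*} [NormedAddCommGroup E] [InnerProductSpace ℂ E] [CompleteSpace E]

/-- Squared weights `α_n²`, extended by `0` for negative indices
(`α_{-1} = α_{-2} = α_{-3} = α_{-4} = 0`). -/
def wsq (α : ℕ → ℝ) : ℤ → ℝ := fun n => if 0 ≤ n then (α n.toNat) ^ 2 else 0

def u (α : ℕ → ℝ) (i : ℤ) : ℝ := wsq α i - wsq α (i - 1)

def w (α : ℕ → ℝ) (i : ℤ) : ℝ := wsq α i * (wsq α (i + 1) - wsq α (i - 1)) ^ 2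

def v (α : ℕ → ℝ) (i : ℤ) : ℝ := wsq α i * wsq α (i + 1) - wsq α (i - 1) * wsq α (i - 2)

def s (α : ℕ → ℝ) (i : ℤ) : ℝ :=
  wsq α i * wsq α (i + 1) * (wsq α (i + 2) - wsq α (i - 1)) ^ 2

def t (α : ℕ → ℝ) (i : ℤ) : ℝ :=
  wsq α i * (wsq α (i + 1) * wsq α (i + 2) - wsq α (i - 1) * wsq α (i - 2)) ^ 2

def p (α : ℕ → ℝ) (i : ℤ) : ℝ :=
  wsq α i * wsq α (i + 1) * wsq α (i + 2) - wsq α (i - 1) * wsq α (i - 2) * wsq α (i - 3)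

def q (α : ℕ → ℝ) (i : ℤ) : ℝ :=
  wsq α i * wsq α (i + 1) * wsq α (i + 2) * (wsq α (i + 3) - wsq α (i - 1)) ^ 2

def f (α : ℕ → ℝ) (i : ℤ) : ℝ :=
  wsq α i * wsq α (i + 1) * (wsq α (i + 2) * wsq α (i + 3) - wsq α (i - 1) * wsq α (i - 2)) ^ 2

def g (α : ℕ → ℝ) (i : ℤ) : ℝ :=
  wsq α i * (wsq α (i + 1) * wsq α (i + 2) * wsq α (i + 3)
    - wsq α (i - 1) * wsq α (i - 2) * wsq α (i - 3)) ^ 2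

def r (α : ℕ → ℝ) (i : ℤ) : ℝ :=
  wsq α i * wsq α (i + 1) * wsq α (i + 2) * wsq α (i + 3)
    - wsq α (i - 1) * wsq α (i - 2) * wsq α (i - 3) * wsq α (i - 4)

/-- The 2×2 matrix `Θ₁`. -/
def Theta1 (α : ℕ → ℝ) : Matrix (Fin 2) (Fin 2) ℝ :=
  !![p α 0, Real.sqrt (g α 0);
     Real.sqrt (g α 0), r α 1]

/-- The 3×3 matrix `Θ₂`. -/
def Theta2 (α : ℕ → ℝ) : Matrix (Fin 3) (Fin 3) ℝ :=
  !![v α 0, Real.sqrt (t α 0), Real.sqrt (f α 0);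
     Real.sqrt (t α 0), p α 1, Real.sqrt (g α 1);
     Real.sqrt (f α 0), Real.sqrt (g α 1), r α 2]

/-- The 4×4 matrices `Δ_i`, `i ≥ 0`. -/
def DeltaMat (α : ℕ → ℝ) (i : ℕ) : Matrix (Fin 4) (Fin 4) ℝ :=
  !![u α i, Real.sqrt (w α i), Real.sqrt (s α i), Real.sqrt (q α i);
     Real.sqrt (w α i), v α (i + 1), Real.sqrt (t α (i + 1)), Real.sqrt (f α (i + 1));
     Real.sqrt (s α i), Real.sqrt (t α (i + 1)), p α (i + 2), Real.sqrt (g α (i + 2));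
     Real.sqrt (q α i), Real.sqrt (f α (i + 1)), Real.sqrt (g α (i + 2)), r α (i + 3)]

/-- The (real-valued) quadratic form `⟨M y, y⟩` of a real symmetric matrix `M`
acting entrywise on a complex vector `y`. -/
def qform {n : ℕ} (M : Matrix (Fin n) (Fin n) ℝ) (y : Fin n → ℂ) : ℝ :=
  ∑ i, ∑ j, M i j * (y j * (starRingEnd ℂ) (y i)).re

/-- A real symmetric matrix is positive semidefinite: `vᵀ M v ≥ 0` for all `v`. -/
def PSDr {n : ℕ} (M : Matrix (Fin n) (Fin n) ℝ) : Prop :=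
  ∀ y : Fin n → ℝ, 0 ≤ y ⬝ᵥ (M *ᵥ y)

/-- Extension of a sequence to `ℤ` by zero. -/
def zeroExt {R : Type*} [Zero R] (a : ℕ → R) (m : ℤ) : R :=
  if 0 ≤ m then a m.toNat else 0

/-- The product `α_m α_{m+1} ⋯ α_{m+k-1}` of `k` consecutive (extended) weights. -/
def weightProd (α : ℕ → ℝ) (m : ℤ) (k : ℕ) : ℝ :=
  ∏ l ∈ Finset.range k, zeroExt α (m + l)

/-- The block of `([W*^j, W^i])_{i,j=1}^k` acting on the span of the vectors `e_{m+i}`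
in the `i`-th coordinate. -/
def commBlock (k : ℕ) (α : ℕ → ℝ) (m : ℤ) : Matrix (Fin k) (Fin k) ℝ :=
  Matrix.of fun i j =>
    weightProd α (m + (i.1 + 1 : ℕ)) (j.1 + 1) * weightProd α (m + (j.1 + 1 : ℕ)) (i.1 + 1)
      - weightProd α m (i.1 + 1) * weightProd α m (j.1 + 1)

section ZeroExt

variable {R : Type*} [Zero R] (a : ℕ → R)

lemma zeroExt_natCast (n : ℕ) : zeroExt a n = a n := by simp [zeroExt]

lemma zeroExt_of_neg {m : ℤ} (hm : m < 0) : zeroExt a m = 0 := by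
  simp [zeroExt, not_le.mpr hm]

end ZeroExt

lemma weightProd_succ (α : ℕ → ℝ) (m : ℤ) (k : ℕ) :
    weightProd α m (k + 1) = weightProd α m k * zeroExt α (m + k) :=
  Finset.prod_range_succ _ _

lemma weightProd_of_neg (α : ℕ → ℝ) {m : ℤ} (hm : m < 0) (k : ℕ) :
    weightProd α m (k + 1) = 0 :=
  Finset.prod_eq_zero (Finset.mem_range.mpr k.succ_pos) (by simpa using zeroExt_of_neg α hm)

lemma commBlock_symm (k : ℕ) (α : ℕ → ℝ) (m : ℤ) (i j : Fin k) :
    commBlock k α m i j = commBlock k α m j i := by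
  simp only [commBlock, Matrix.of_apply]
  ring

lemma commBlock_of_neg_left {k : ℕ} (α : ℕ → ℝ) {m : ℤ} {i : Fin k}
    (h : m + (i.1 + 1 : ℕ) < 0) (j : Fin k) : commBlock k α m i j = 0 := by
  simp only [commBlock, Matrix.of_apply]
  rw [weightProd_of_neg α h, weightProd_of_neg α (show m < 0 by omega) i]
  ring

lemma commBlock_of_neg_right {k : ℕ} (α : ℕ → ℝ) {m : ℤ} (i : Fin k) {j : Fin k}
    (h : m + (j.1 + 1 : ℕ) < 0) : commBlock k α m i j = 0 := by
  rw [commBlock_symm, commBlock_of_neg_left α h]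

lemma inner_e_left (n : ℕ) (x : H) : inner ℂ (e n) x = x n := by
  simp [e, lp.inner_single_left]

lemma hasSum_inner_zeroExt (x y : H) :
    HasSum (fun m : ℤ => (starRingEnd ℂ) (zeroExt x m) * zeroExt y m) (inner ℂ x y) := by
  refine (Function.Injective.hasSum_iff (g := ((↑) : ℕ → ℤ)) Nat.cast_injective ?_).mp ?_
  · intro m hm
    have : m < 0 := by
      by_contra! h
      exact hm ⟨m.toNat, Int.toNat_of_nonneg h⟩
    simp [zeroExt_of_neg _ this]
  · refine (lp.hasSum_inner x y).congr_fun fun n => ?_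
    simp [zeroExt_natCast, mul_comm]

namespace IsWeightedShift

variable {α : ℕ → ℝ} {W : H →L[ℂ] H}

lemma adjoint_apply (hW : IsWeightedShift α W) (x : H) (n : ℕ) : adjoint W x n = α n * x (n + 1) := by
  rw [← inner_e_left, adjoint_inner_right, hW, inner_smul_left, inner_e_left, Complex.conj_ofReal]

lemma adjoint_e_zero (hW : IsWeightedShift α W) : adjoint W (e 0) = 0 := by
  ext n
  rw [hW.adjoint_apply]
  simp [e]

lemma adjoint_e_succ (hW : IsWeightedShift α W) (n : ℕ) : adjoint W (e (n + 1)) = (α n : ℂ) • e n := by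
  ext l
  rw [hW.adjoint_apply]
  by_cases h : l = n
  · subst h
    rw [lp.coeFn_smul]
    simp [e]
  · rw [lp.coeFn_smul]
    simp [e, h]

lemma zeroExt_apply (hW : IsWeightedShift α W) (x : H) (m : ℤ) :
    zeroExt (W x) (m + 1) = zeroExt α m * zeroExt x m := by
  rcases lt_trichotomy m (-1) with h | rfl | h
  · simp [zeroExt_of_neg _ (show m + 1 < 0 by omega), zeroExt_of_neg _ (show m < 0 by omega)]
  · have : W x 0 = 0 := by
      rw [← inner_e_left, ← adjoint_inner_left, hW.adjoint_e_zero, inner_zero_left]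
    simpa [zeroExt] using this
  · lift m to ℕ using by omega
    rw [← Nat.cast_succ, zeroExt_natCast, zeroExt_natCast, zeroExt_natCast, ← inner_e_left,
      ← adjoint_inner_left, hW.adjoint_e_succ, inner_smul_left, inner_e_left, Complex.conj_ofReal]

lemma zeroExt_adjoint_apply (hW : IsWeightedShift α W) (x : H) (m : ℤ) :
    zeroExt (adjoint W x) m = zeroExt α m * zeroExt x (m + 1) := by
  rcases lt_or_ge m 0 with h | h
  · simp [zeroExt_of_neg _ h]
  · lift m to ℕ using h
    rw [← Nat.cast_succ, zeroExt_natCast, zeroExt_natCast, zeroExt_natCast, hW.adjoint_apply]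

lemma zeroExt_pow_apply (hW : IsWeightedShift α W) (x : H) (k : ℕ) (m : ℤ) :
    zeroExt ((W ^ k) x) (m + k) = weightProd α m k * zeroExt x m := by
  induction k with
  | zero => simp [weightProd]
  | succ k ih =>
    rw [pow_succ', mul_apply_eq_comp, Nat.cast_succ, ← add_assoc, hW.zeroExt_apply, ih, weightProd_succ]
    push_cast
    ring

lemma zeroExt_adjoint_pow_apply (hW : IsWeightedShift α W) (x : H) (k : ℕ) (m : ℤ) :
    zeroExt ((adjoint W ^ k) x) m = weightProd α m k * zeroExt x (m + k) := by
  induction k generalizing x with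
  | zero => simp [weightProd]
  | succ k ih =>
    rw [pow_succ, mul_apply_eq_comp, ih, hW.zeroExt_adjoint_apply, weightProd_succ]
    push_cast
    rw [add_assoc]
    ring

lemma hasSum_inner_pow (hW : IsWeightedShift α W) (x y : H) (i j : ℕ) :
    HasSum (fun m : ℤ => (starRingEnd ℂ) (zeroExt x (m + i)) * zeroExt y (m + j) *
        (weightProd α (m + i) j * weightProd α (m + j) i : ℝ))
      (inner ℂ x ((adjoint W ^ j * W ^ i) y)) := by
  rw [mul_apply_eq_comp, ← star_eq_adjoint, ← star_pow, star_eq_adjoint, adjoint_inner_right]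
  refine ((Equiv.addRight ((i : ℤ) + j)).hasSum_iff.mpr
    (hasSum_inner_zeroExt ((W ^ j) x) ((W ^ i) y))).congr_fun fun m => ?_
  simp only [Function.comp_apply, Equiv.coe_addRight]
  rw [← add_assoc, hW.zeroExt_pow_apply, add_right_comm, hW.zeroExt_pow_apply]
  simp only [map_mul, Complex.conj_ofReal]
  push_cast
  ring

lemma hasSum_inner_adjoint_pow (hW : IsWeightedShift α W) (x y : H) (i j : ℕ) :
    HasSum (fun m : ℤ => (starRingEnd ℂ) (zeroExt x (m + i)) * zeroExt y (m + j) *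
        (weightProd α m i * weightProd α m j : ℝ))
      (inner ℂ x ((W ^ i * adjoint W ^ j) y)) := by
  rw [mul_apply_eq_comp, ← adjoint_inner_left, ← star_eq_adjoint, star_pow, star_eq_adjoint]
  refine (hasSum_inner_zeroExt ((adjoint W ^ i) x) ((adjoint W ^ j) y)).congr_fun fun m => ?_
  rw [hW.zeroExt_adjoint_pow_apply, hW.zeroExt_adjoint_pow_apply]
  simp only [map_mul, Complex.conj_ofReal]
  push_cast
  ring

lemma hasSum_commBlock (hW : IsWeightedShift α W) {k : ℕ} (x : Fin k → H) :
    HasSum (fun m : ℤ => ∑ i, ∑ j,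
        (starRingEnd ℂ) (zeroExt (x i) (m + (i.1 + 1 : ℕ))) * zeroExt (x j) (m + (j.1 + 1 : ℕ)) *
          (commBlock k α m i j : ℝ))
      (∑ i, ∑ j, (inner ℂ (x i) ((adjoint W ^ (j.1 + 1) * W ^ (i.1 + 1)
        - W ^ (i.1 + 1) * adjoint W ^ (j.1 + 1)) (x j)) : ℂ)) := by
  refine hasSum_sum fun i _ => hasSum_sum fun j _ => ?_
  rw [_root_.sub_apply, inner_sub_right]
  refine ((hW.hasSum_inner_pow (x i) (x j) (i.1 + 1) (j.1 + 1)).sub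
    (hW.hasSum_inner_adjoint_pow (x i) (x j) (i.1 + 1) (j.1 + 1))).congr_fun fun m => ?_
  simp only [commBlock, Matrix.of_apply]
  push_cast
  ring

end IsWeightedShift

lemma dotProduct_mulVec_eq_sum {k : ℕ} (M : Matrix (Fin k) (Fin k) ℝ) (y : Fin k → ℝ) :
    y ⬝ᵥ (M *ᵥ y) = ∑ i, ∑ j, y i * y j * M i j := by
  simp only [dotProduct, mulVec, Finset.mul_sum]
  exact Finset.sum_congr rfl fun i _ => Finset.sum_congr rfl fun j _ => by ring

lemma PSDr.sum_conj_mul_nonneg {k : ℕ} {M : Matrix (Fin k) (Fin k) ℝ} (hM : PSDr M)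
    (hsymm : ∀ i j, M i j = M j i) (z : Fin k → ℂ) :
    (0 : ℂ) ≤ ∑ i, ∑ j, (starRingEnd ℂ) (z i) * z j * (M i j : ℝ) := by
  rw [Complex.le_def]
  constructor
  · have h := add_nonneg (hM fun i => (z i).re) (hM fun i => (z i).im)
    rw [dotProduct_mulVec_eq_sum, dotProduct_mulVec_eq_sum, ← Finset.sum_add_distrib] at h
    simp only [← Finset.sum_add_distrib] at h
    simpa [Complex.re_sum, add_mul] using h
  · have h : ∑ i, ∑ j, (z i).im * (z j).re * M i j = ∑ i, ∑ j, (z i).re * (z j).im * M i j := by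
      rw [Finset.sum_comm]
      refine Finset.sum_congr rfl fun i _ => Finset.sum_congr rfl fun j _ => ?_
      rw [hsymm j i]
      ring
    simp [Complex.im_sum, add_mul, Finset.sum_add_distrib, h]

/-- A weighted shift is `k`-hyponormal iff all its commutator blocks are positive semidefinite. -/
theorem IsWeightedShift.kHyponormal_iff {α : ℕ → ℝ} {W : H →L[ℂ] H} (hW : IsWeightedShift α W)
    (k : ℕ) : KHyponormal k W ↔ ∀ m : ℤ, PSDr (commBlock k α m) := by
  constructor
  · intro h m y
    let x : Fin k → H := fun i =>
      if 0 ≤ m + (i.1 + 1 : ℕ) then lp.single 2 (m + (i.1 + 1 : ℕ)).toNat (y i : ℂ) else 0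
    have hx_ne : ∀ i (n : ℤ), n ≠ m + (i.1 + 1 : ℕ) → zeroExt (x i) n = 0 := by
      intro i n hn
      by_cases hn0 : 0 ≤ n
      · by_cases hm : 0 ≤ m + (i.1 + 1 : ℕ)
        · have : n.toNat ≠ (m + (i.1 + 1 : ℕ)).toNat := by omega
          simp only [zeroExt, x, if_pos hn0, if_pos hm]
          rw [lp.single_apply_ne _ _ _ this]
        · simp only [zeroExt, x, if_neg hm]
          simp
      · exact zeroExt_of_neg _ (not_le.mp hn0)
    have hx : ∀ i, 0 ≤ m + (i.1 + 1 : ℕ) → zeroExt (x i) (m + (i.1 + 1 : ℕ)) = y i := by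
      intro i hi
      simp only [zeroExt, x, if_pos hi]
      simp
    have hsum := (hW.hasSum_commBlock x).unique (hasSum_single m fun m' hm' =>
      Finset.sum_eq_zero fun i _ => Finset.sum_eq_zero fun j _ => by
        rw [hx_ne i _ (by omega)]; simp)
    have hnonneg := h x
    rw [hsum] at hnonneg
    have hQ : (∑ i, ∑ j, (starRingEnd ℂ) (zeroExt (x i) (m + (i.1 + 1 : ℕ))) *
        zeroExt (x j) (m + (j.1 + 1 : ℕ)) * (commBlock k α m i j : ℝ)) =
        ((y ⬝ᵥ (commBlock k α m *ᵥ y) : ℝ) : ℂ) := by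
      rw [dotProduct_mulVec_eq_sum, Complex.ofReal_sum]
      refine Finset.sum_congr rfl fun i _ => ?_
      rw [Complex.ofReal_sum]
      refine Finset.sum_congr rfl fun j _ => ?_
      rcases lt_or_ge (m + (i.1 + 1 : ℕ)) 0 with hi | hi
      · simp [commBlock_of_neg_left α hi]
      rcases lt_or_ge (m + (j.1 + 1 : ℕ)) 0 with hj | hj
      · simp [commBlock_of_neg_right α i hj]
      rw [hx i hi, hx j hj, Complex.conj_ofReal]
      push_cast
      ring
    rw [hQ] at hnonneg
    exact_mod_cast hnonneg
  · intro h x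
    exact (hW.hasSum_commBlock x).nonneg fun m =>
      (h m).sum_conj_mul_nonneg (commBlock_symm k α m) _

lemma PSDr.diag_nonneg {k : ℕ} {M : Matrix (Fin k) (Fin k) ℝ} (hM : PSDr M) (i : Fin k) :
    0 ≤ M i i := by
  simpa using hM (Pi.single i 1)

lemma wsq_eq (α : ℕ → ℝ) (m : ℤ) : wsq α m = zeroExt α m ^ 2 := by
  unfold wsq zeroExt
  split_ifs <;> simp

lemma zeroExt_nonneg {α : ℕ → ℝ} (hpos : ∀ n, 0 < α n) (m : ℤ) : 0 ≤ zeroExt α m := by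
  unfold zeroExt
  split_ifs
  exacts [(hpos _).le, le_rfl]

lemma monotone_zeroExt_of_u_nonneg {α : ℕ → ℝ} (hpos : ∀ n, 0 < α n)
    (hu : ∀ i : ℕ, 0 ≤ u α i) : Monotone (zeroExt α) := by
  refine monotone_int_of_le_succ fun m => ?_
  rcases lt_or_ge m 0 with hm | hm
  · rw [zeroExt_of_neg α hm]
    exact zeroExt_nonneg hpos _
  · have h := hu (m + 1).toNat
    rw [Int.toNat_of_nonneg (by omega), u, wsq_eq, wsq_eq, add_sub_cancel_right, sub_nonneg] at h
    exact (sq_le_sq₀ (zeroExt_nonneg hpos _) (zeroExt_nonneg hpos _)).mp h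

section Entries

variable {α : ℕ → ℝ}

lemma sqrt_w (hpos : ∀ n, 0 < α n) (hmono : Monotone (zeroExt α)) (m : ℤ) : √(w α m) =
    zeroExt α m * (zeroExt α (m + 1) ^ 2 - zeroExt α (m - 1) ^ 2) := by
  have h0 := zeroExt_nonneg hpos
  simp only [w, wsq_eq]
  rw [← mul_pow, Real.sqrt_sq]
  have : zeroExt α (m - 1) ≤ zeroExt α (m + 1) := hmono (by omega)
  exact mul_nonneg (h0 _) (sub_nonneg.mpr (by gcongr; exact h0 _))

lemma sqrt_s (hpos : ∀ n, 0 < α n) (hmono : Monotone (zeroExt α)) (m : ℤ) : √(s α m) =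
    zeroExt α m * zeroExt α (m + 1) * (zeroExt α (m + 2) ^ 2 - zeroExt α (m - 1) ^ 2) := by
  have h0 := zeroExt_nonneg hpos
  simp only [s, wsq_eq]
  rw [← mul_pow, ← mul_pow, Real.sqrt_sq]
  have : zeroExt α (m - 1) ≤ zeroExt α (m + 2) := hmono (by omega)
  exact mul_nonneg (mul_nonneg (h0 _) (h0 _)) (sub_nonneg.mpr (by gcongr; exact h0 _))

lemma sqrt_t (hpos : ∀ n, 0 < α n) (hmono : Monotone (zeroExt α)) (m : ℤ) : √(t α m) =
    zeroExt α m * (zeroExt α (m + 1) ^ 2 * zeroExt α (m + 2) ^ 2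
      - zeroExt α (m - 1) ^ 2 * zeroExt α (m - 2) ^ 2) := by
  have h0 := zeroExt_nonneg hpos
  simp only [t, wsq_eq]
  rw [← mul_pow (zeroExt α m), Real.sqrt_sq]
  have h₁ : zeroExt α (m - 1) ≤ zeroExt α (m + 1) := hmono (by omega)
  have h₂ : zeroExt α (m - 2) ≤ zeroExt α (m + 2) := hmono (by omega)
  exact mul_nonneg (h0 _) (sub_nonneg.mpr (by gcongr <;> exact h0 _))

lemma sqrt_q (hpos : ∀ n, 0 < α n) (hmono : Monotone (zeroExt α)) (m : ℤ) : √(q α m) =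
    zeroExt α m * zeroExt α (m + 1) * zeroExt α (m + 2) *
      (zeroExt α (m + 3) ^ 2 - zeroExt α (m - 1) ^ 2) := by
  have h0 := zeroExt_nonneg hpos
  simp only [q, wsq_eq]
  rw [← mul_pow, ← mul_pow, ← mul_pow, Real.sqrt_sq]
  have : zeroExt α (m - 1) ≤ zeroExt α (m + 3) := hmono (by omega)
  exact mul_nonneg (mul_nonneg (mul_nonneg (h0 _) (h0 _)) (h0 _))
    (sub_nonneg.mpr (by gcongr; exact h0 _))

lemma sqrt_f (hpos : ∀ n, 0 < α n) (hmono : Monotone (zeroExt α)) (m : ℤ) : √(f α m) =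
    zeroExt α m * zeroExt α (m + 1) * (zeroExt α (m + 2) ^ 2 * zeroExt α (m + 3) ^ 2
      - zeroExt α (m - 1) ^ 2 * zeroExt α (m - 2) ^ 2) := by
  have h0 := zeroExt_nonneg hpos
  simp only [f, wsq_eq]
  rw [← mul_pow (zeroExt α m), ← mul_pow (zeroExt α m * _), Real.sqrt_sq]
  have h₁ : zeroExt α (m - 1) ≤ zeroExt α (m + 2) := hmono (by omega)
  have h₂ : zeroExt α (m - 2) ≤ zeroExt α (m + 3) := hmono (by omega)
  exact mul_nonneg (mul_nonneg (h0 _) (h0 _)) (sub_nonneg.mpr (by gcongr <;> exact h0 _))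

lemma sqrt_g (hpos : ∀ n, 0 < α n) (hmono : Monotone (zeroExt α)) (m : ℤ) : √(g α m) =
    zeroExt α m * (zeroExt α (m + 1) ^ 2 * zeroExt α (m + 2) ^ 2 * zeroExt α (m + 3) ^ 2
      - zeroExt α (m - 1) ^ 2 * zeroExt α (m - 2) ^ 2 * zeroExt α (m - 3) ^ 2) := by
  have h0 := zeroExt_nonneg hpos
  simp only [g, wsq_eq]
  rw [← mul_pow (zeroExt α m), Real.sqrt_sq]
  have h₁ : zeroExt α (m - 1) ≤ zeroExt α (m + 1) := hmono (by omega)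
  have h₂ : zeroExt α (m - 2) ≤ zeroExt α (m + 2) := hmono (by omega)
  have h₃ : zeroExt α (m - 3) ≤ zeroExt α (m + 3) := hmono (by omega)
  exact mul_nonneg (h0 _) (sub_nonneg.mpr (by gcongr <;> exact h0 _))

lemma commBlock_four_eq_deltaMat (hpos : ∀ n, 0 < α n) (hmono : Monotone (zeroExt α))
    (i : ℕ) : commBlock 4 α (i - 1) = DeltaMat α i := by
  have hw := sqrt_w hpos hmono
  have hs := sqrt_s hpos hmono
  have ht := sqrt_t hpos hmono
  have hq := sqrt_q hpos hmono
  have hf := sqrt_f hpos hmono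
  have hg := sqrt_g hpos hmono
  ext a b
  fin_cases a <;> fin_cases b <;>
    simp [commBlock, DeltaMat, weightProd, Finset.prod_range_succ, hw, hs, ht, hq, hf, hg,
      u, v, p, r, wsq_eq] <;>
    ring_nf

lemma commBlock_four_submatrix_succ (hpos : ∀ n, 0 < α n) (hmono : Monotone (zeroExt α)) :
    (commBlock 4 α (-2)).submatrix Fin.succ Fin.succ = Theta2 α := by
  have hneg : ∀ m : ℤ, m < 0 → zeroExt α m = 0 := fun m => zeroExt_of_neg α
  have ht := sqrt_t hpos hmono
  have hf := sqrt_f hpos hmono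
  have hg := sqrt_g hpos hmono
  ext a b
  fin_cases a <;> fin_cases b <;>
    simp [commBlock, Theta2, weightProd, Finset.prod_range_succ, ht, hf, hg, v, p, r, wsq_eq,
      hneg] <;>
    ring_nf

lemma dotProduct_commBlock_neg_two (hpos : ∀ n, 0 < α n) (hmono : Monotone (zeroExt α))
    (y : Fin 4 → ℝ) :
    y ⬝ᵥ (commBlock 4 α (-2) *ᵥ y) =
      (fun i : Fin 3 => y i.succ) ⬝ᵥ (Theta2 α *ᵥ fun i => y i.succ) := by
  have hrow : ∀ j, commBlock 4 α (-2) 0 j = 0 := commBlock_of_neg_left α (by simp)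
  have hcol : ∀ i, commBlock 4 α (-2) i 0 = 0 := fun i => commBlock_of_neg_right α i (by simp)
  rw [← commBlock_four_submatrix_succ hpos hmono, dotProduct_mulVec_eq_sum,
    dotProduct_mulVec_eq_sum, Fin.sum_univ_succ]
  simp [Fin.sum_univ_succ (n := 3), hrow, hcol]

lemma psdr_commBlock_neg_three (hpos : ∀ n, 0 < α n) (hmono : Monotone (zeroExt α))
    : PSDr (commBlock 4 α (-3)) := by
  have hneg : ∀ m : ℤ, m < 0 → zeroExt α m = 0 := fun m => zeroExt_of_neg α
  have h34 : zeroExt α 3 ^ 2 ≤ zeroExt α 4 ^ 2 :=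
    pow_le_pow_left₀ (zeroExt_nonneg hpos 3) (hmono (by norm_num)) 2
  intro y
  have key : y ⬝ᵥ (commBlock 4 α (-3) *ᵥ y) =
      (zeroExt α 0 * zeroExt α 1 * zeroExt α 2 * y 2 +
        zeroExt α 1 * zeroExt α 2 * zeroExt α 3 ^ 2 * y 3) ^ 2 +
      (zeroExt α 1 * zeroExt α 2 * zeroExt α 3 * y 3) ^ 2 *
        (zeroExt α 4 ^ 2 - zeroExt α 3 ^ 2) := by
    simp [dotProduct_mulVec_eq_sum, Fin.sum_univ_succ, commBlock, weightProd,
      Finset.prod_range_succ, hneg]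
    ring
  rw [key]
  exact add_nonneg (sq_nonneg _) (mul_nonneg (sq_nonneg _) (sub_nonneg.mpr h34))

end Entries

lemma psdr_commBlock_of_le_neg_four (α : ℕ → ℝ) {m : ℤ} (hm : m ≤ -4) :
    PSDr (commBlock 4 α m) := by
  intro y
  rw [dotProduct_mulVec_eq_sum]
  refine Finset.sum_nonneg fun i _ => Finset.sum_nonneg fun j _ => ?_
  rcases lt_or_ge (m + (i.1 + 1 : ℕ)) 0 with hi | hi
  · simp [commBlock_of_neg_left α hi]
  rcases lt_or_ge (m + (j.1 + 1 : ℕ)) 0 with hj | hj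
  · simp [commBlock_of_neg_right α i hj]
  obtain rfl : i = j := by ext; omega
  simp only [commBlock, Matrix.of_apply, weightProd_of_neg α (show m < 0 by omega)]
  nlinarith [mul_nonneg (mul_self_nonneg (y i))
    (mul_self_nonneg (weightProd α (m + (i.1 + 1 : ℕ)) (i.1 + 1)))]

/-- A weighted shift is 4-hyponormal iff `Θ₂ ≥ 0` and `Δ_i ≥ 0` for all `i ≥ 0`. -/
theorem four_hyponormal_iff (α : ℕ → ℝ)
    (hbd : ∃ C : ℝ, ∀ n, α n ≤ C) (hpos : ∀ n, 0 < α n)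
    (W : H →L[ℂ] H) (hW : IsWeightedShift α W) :
    KHyponormal 4 W ↔ PSDr (Theta2 α) ∧ ∀ i : ℕ, PSDr (DeltaMat α i) := by
  rw [hW.kHyponormal_iff]
  constructor
  · intro h
    have hmono : Monotone (zeroExt α) := monotone_zeroExt_of_u_nonneg hpos fun i => by
      simpa [commBlock, weightProd, u, wsq_eq, ← sq] using (h (i - 1)).diag_nonneg 0
    refine ⟨fun y => ?_, fun i => commBlock_four_eq_deltaMat hpos hmono i ▸ h _⟩
    simpa [dotProduct_commBlock_neg_two hpos hmono] using h (-2) (Fin.cons 0 y)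
  · rintro ⟨hΘ, hΔ⟩ m
    have hmono : Monotone (zeroExt α) := monotone_zeroExt_of_u_nonneg hpos fun i =>
      (hΔ i).diag_nonneg 0
    rcases le_or_gt m (-4) with hm | hm
    · exact psdr_commBlock_of_le_neg_four α hm
    obtain rfl | rfl | hm : m = -3 ∨ m = -2 ∨ -1 ≤ m := by omega
    · exact psdr_commBlock_neg_three hpos hmono
    · intro y
      rw [dotProduct_commBlock_neg_two hpos hmono]
      exact hΘ _
    · obtain ⟨i, hi⟩ := Int.eq_ofNat_of_zero_le (show 0 ≤ m + 1 by omega)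
      obtain rfl : m = i - 1 := by omega
      exact commBlock_four_eq_deltaMat hpos hmono i ▸ hΔ i
end
end

section
/- For x > 0, let α(x) be the weight sequence α_0 := √x and α_n := √((n+2)/(n+3)) for n ≥ 1, and let W_{α(x)} be the associated unilateral weighted shift on ℓ²(ℕ, ℂ). Then for every integer k ≥ 1, the shift W_{α(x)} is k-hyponormal if and only if 0 < x ≤ 2(k+1)²(k+2)² / (3k(k+3)(k²+3k+4)). -/
open scoped ComplexOrder
open ContinuousLinearMap

noncomputable section

variable {E : Type*} [NormedAddCommGroup E] [InnerProductSpace ℂ E] [CompleteSpace E]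

/-- The weight sequence of Theorem 4: `α₀ = √x`, `α_n = √((n+2)/(n+3))` for `n ≥ 1`. -/
def alphaX (x : ℝ) : ℕ → ℝ := fun n =>
  if n = 0 then Real.sqrt x else Real.sqrt (((n : ℝ) + 2) / ((n : ℝ) + 3))

/-- The quadratic form of the Cauchy matrix `(1 / (a i + a j))` on the indices in `S`. -/
def cauchyForm {ι : Type*} (a c : ι → ℝ) (S : Finset ι) : ℝ :=
  ∑ i ∈ S, ∑ j ∈ S, c i * c j / (a i + a j)

section CauchyForm

variable {ι : Type*} {a : ι → ℝ}

theorem cauchyForm_congr {c d : ι → ℝ} {S : Finset ι} (h : ∀ i ∈ S, c i = d i) :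
    cauchyForm a c S = cauchyForm a d S :=
  Finset.sum_congr rfl fun i hi => Finset.sum_congr rfl fun j hj => by rw [h i hi, h j hj]

theorem cauchyForm_const_mul (r : ℝ) (c : ι → ℝ) (S : Finset ι) :
    cauchyForm a (fun i => r * c i) S = r ^ 2 * cauchyForm a c S := by
  simp only [cauchyForm, Finset.mul_sum]
  exact Finset.sum_congr rfl fun i _ => Finset.sum_congr rfl fun j _ => by ring

variable [DecidableEq ι]

/-- Completing the square (Schur complement) for Cauchy forms. -/
theorem cauchyForm_insert (ha : ∀ i, 0 < a i) (c : ι → ℝ) {S : Finset ι} {p : ι} (hp : p ∉ S) :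
    cauchyForm a c (insert p S) =
      2 * a p * (c p / (2 * a p) + ∑ i ∈ S, c i / (a i + a p)) ^ 2 +
        cauchyForm a (fun i => c i * ((a i - a p) / (a i + a p))) S := by
  have hterm : ∀ i j, c i * c j / (a i + a j) =
      2 * a p * (c i / (a i + a p) * (c j / (a j + a p))) +
        c i * ((a i - a p) / (a i + a p)) * (c j * ((a j - a p) / (a j + a p))) / (a i + a j) := by
    intro i j
    have h1 : a i + a p ≠ 0 := (add_pos (ha i) (ha p)).ne'
    have h2 : a j + a p ≠ 0 := (add_pos (ha j) (ha p)).ne'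
    have h3 : a i + a j ≠ 0 := (add_pos (ha i) (ha j)).ne'
    field_simp
    ring
  have hS : cauchyForm a c S = 2 * a p * (∑ i ∈ S, c i / (a i + a p)) ^ 2 +
      cauchyForm a (fun i => c i * ((a i - a p) / (a i + a p))) S := by
    simp only [cauchyForm]
    rw [sq, Finset.sum_mul_sum, Finset.mul_sum, ← Finset.sum_add_distrib]
    refine Finset.sum_congr rfl fun i _ => ?_
    rw [Finset.mul_sum, ← Finset.sum_add_distrib]
    exact Finset.sum_congr rfl fun j _ => hterm i j
  have hrow : ∑ j ∈ S, c p * c j / (a p + a j) = c p * ∑ i ∈ S, c i / (a i + a p) := by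
    rw [Finset.mul_sum]
    exact Finset.sum_congr rfl fun j _ => by rw [add_comm, mul_div_assoc]
  have hcol : ∑ i ∈ S, c i * c p / (a i + a p) = c p * ∑ i ∈ S, c i / (a i + a p) := by
    rw [Finset.mul_sum]
    exact Finset.sum_congr rfl fun j _ => by rw [mul_comm (c j), mul_div_assoc]
  have hexp : cauchyForm a c (insert p S) = c p * c p / (a p + a p) +
      2 * (c p * ∑ i ∈ S, c i / (a i + a p)) + cauchyForm a c S := by
    simp only [cauchyForm, Finset.sum_insert hp, Finset.sum_add_distrib]
    rw [hrow, hcol]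
    ring
  rw [hexp, hS]
  have h := (ha p).ne'
  field_simp
  ring

theorem cauchyForm_nonneg (ha : ∀ i, 0 < a i) (c : ι → ℝ) (S : Finset ι) :
    0 ≤ cauchyForm a c S := by
  induction S using Finset.induction_on generalizing c with
  | empty => simp [cauchyForm]
  | insert p S hp ih =>
    rw [cauchyForm_insert ha c hp]
    have := ha p
    have := ih fun i => c i * ((a i - a p) / (a i + a p))
    positivity

theorem le_cauchyForm_insert (ha : ∀ i, 0 < a i) (c : ι → ℝ) {S : Finset ι} {z : ι} (hz : z ∉ S) :
    c z ^ 2 / (2 * a z) * ∏ p ∈ S, ((a z - a p) / (a z + a p)) ^ 2 ≤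
      cauchyForm a c (insert z S) := by
  induction S using Finset.induction_on generalizing c with
  | empty => simp [cauchyForm, sq, two_mul]
  | insert p S hp ih =>
    rw [Finset.mem_insert, not_or] at hz
    have hp' : p ∉ insert z S := by simp [hp, Ne.symm hz.1]
    rw [Finset.insert_comm, cauchyForm_insert ha c hp', Finset.prod_insert hp]
    have h1 := ih (fun i => c i * ((a i - a p) / (a i + a p))) hz.2
    have := ha p
    refine le_add_of_nonneg_of_le (by positivity) (le_trans (le_of_eq ?_) h1)
    ring

/-- The lower bound `le_cauchyForm_insert` is attained. -/
theorem exists_cauchyForm_insert_eq (ha : ∀ i, 0 < a i) (hinj : Function.Injective a)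
    {S : Finset ι} {z : ι} (hz : z ∉ S) :
    ∃ c : ι → ℝ, c z = 1 ∧ cauchyForm a c (insert z S) =
      1 / (2 * a z) * ∏ p ∈ S, ((a z - a p) / (a z + a p)) ^ 2 := by
  induction S using Finset.induction_on with
  | empty => exact ⟨fun _ => 1, rfl, by simp [cauchyForm, two_mul]⟩
  | insert p S hp ih =>
    rw [Finset.mem_insert, not_or] at hz
    have hp' : p ∉ insert z S := by simp [hp, Ne.symm hz.1]
    obtain ⟨d, hd1, hd⟩ := ih hz.2
    set r := (a z - a p) / (a z + a p) with hr
    let b : ι → ℝ := fun i => r * d i * ((a i + a p) / (a i - a p))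
    have hsub : ∀ i, i ≠ p → a i - a p ≠ 0 := fun i hi => sub_ne_zero.2 (hinj.ne hi)
    have hadd : ∀ i, a i + a p ≠ 0 := fun i => (add_pos (ha i) (ha p)).ne'
    refine ⟨Function.update b p (-(2 * a p) * ∑ i ∈ insert z S, b i / (a i + a p)), ?_, ?_⟩
    · rw [Function.update_of_ne hz.1]
      have := hsub z hz.1
      have := hadd z
      simp only [b, hd1, hr]
      field_simp
    · rw [Finset.insert_comm, cauchyForm_insert ha _ hp', Finset.prod_insert hp, ← hr]
      have hne : ∀ i ∈ insert z S, i ≠ p := fun i hi h => hp' (h ▸ hi)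
      have hsum : ∑ i ∈ insert z S, Function.update b p
          (-(2 * a p) * ∑ i ∈ insert z S, b i / (a i + a p)) i / (a i + a p) =
          ∑ i ∈ insert z S, b i / (a i + a p) :=
        Finset.sum_congr rfl fun i hi => by rw [Function.update_of_ne (hne i hi)]
      rw [hsum, Function.update_self, cauchyForm_congr (d := fun i => r * d i),
        cauchyForm_const_mul, hd]
      · have := (ha p).ne'
        field_simp
        ring
      · intro i hi
        rw [Function.update_of_ne (hne i hi)]
        have := hsub i (hne i hi)
        have := hadd i
        simp only [b]
        field_simp

end CauchyForm

section Moments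

/-- Moments of the shift with weights `alphaX x`, extended to `ℤ` by the same formula. -/
def moment (x : ℝ) (n : ℤ) : ℝ := if n = 0 then 1 else 3 * x / (n + 2)

theorem moment_pos {x : ℝ} (hx : 0 < x) {n : ℤ} (hn : 0 ≤ n) : 0 < moment x n := by
  have : (0 : ℝ) ≤ n := by exact_mod_cast hn
  unfold moment
  split_ifs <;> positivity

theorem sqrt_moment_succ {x : ℝ} (hx : 0 < x) (n : ℕ) :
    √(moment x ((n : ℤ) + 1)) = alphaX x n * √(moment x n) := by
  have h : ((n : ℤ) + 1) ≠ 0 := by omega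
  rcases Nat.eq_zero_or_pos n with rfl | hn
  · simp [moment, alphaX]
    norm_num
  · have h0 : n ≠ 0 := hn.ne'
    rw [alphaX, if_neg h0, ← Real.sqrt_mul (by positivity)]
    simp only [moment, h, h0, Nat.cast_eq_zero, if_false]
    congr 1
    push_cast
    field_simp
    ring

theorem prod_sub_div_add (k : ℕ) :
    ∏ p ∈ Finset.Ico 1 (k + 1), (((0 : ℕ) + 1 - ((p : ℝ) + 1)) / ((0 : ℕ) + 1 + ((p : ℝ) + 1))) ^ 2 =
      4 / (((k : ℝ) + 1) ^ 2 * ((k : ℝ) + 2) ^ 2) := by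
  induction k with
  | zero => norm_num
  | succ k ih =>
    rw [Finset.prod_Ico_succ_top (by omega), ih]
    push_cast
    field_simp
    ring

theorem range_succ_eq_insert (k : ℕ) : Finset.range (k + 1) = insert 0 (Finset.Ico 1 (k + 1)) := by
  ext i
  simp
  omega

/-- The critical Hankel form splits as a Cauchy form plus a rank-one perturbation. -/
theorem sum_moment_zero (x : ℝ) (k : ℕ) (c : ℕ → ℝ) :
    ∑ i ∈ Finset.range (k + 1), ∑ j ∈ Finset.range (k + 1),
        moment x ((0 : ℤ) + i + j) * (c i * c j) =
      3 * x * cauchyForm (fun i : ℕ => (i : ℝ) + 1) c (insert 0 (Finset.Ico 1 (k + 1))) +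
        (1 - 3 * x / 2) * c 0 ^ 2 := by
  have hterm : ∀ i j : ℕ, moment x ((0 : ℤ) + i + j) * (c i * c j) =
      3 * x * (c i * c j / ((i : ℝ) + 1 + ((j : ℝ) + 1))) +
        if i = 0 then if j = 0 then (1 - 3 * x / 2) * c 0 ^ 2 else 0 else 0 := by
    intro i j
    have hden : (i : ℝ) + j + 2 ≠ 0 := by positivity
    have hden' : (i : ℝ) + 1 + (j + 1) ≠ 0 := by positivity
    by_cases hi : i = 0
    · by_cases hj : j = 0
      · subst hi hj
        simp [moment]
        ring
      · subst hi
        simp [moment, hj]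
        field_simp
        ring
    · have : (0 : ℤ) + i + j ≠ 0 := by omega
      simp only [moment, this, hi, if_false]
      push_cast
      field_simp
      ring
  simp only [hterm, Finset.sum_add_distrib, cauchyForm, ← range_succ_eq_insert, Finset.mul_sum]
  simp

theorem sum_moment_nonneg {x : ℝ} (hx : 0 < x) {k : ℕ}
    (hk : 0 ≤ 3 * x * (2 / (((k : ℝ) + 1) ^ 2 * ((k : ℝ) + 2) ^ 2)) + (1 - 3 * x / 2))
    (m : ℤ) (c : ℕ → ℝ) (hc : ∀ i : ℕ, m + i < 0 → c i = 0) :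
    0 ≤ ∑ i ∈ Finset.range (k + 1), ∑ j ∈ Finset.range (k + 1),
      moment x (m + i + j) * (c i * c j) := by
  rcases eq_or_ne m 0 with rfl | hm
  · rw [sum_moment_zero]
    have h := le_cauchyForm_insert (a := fun i : ℕ => (i : ℝ) + 1) (fun i => by positivity) c
      (S := Finset.Ico 1 (k + 1)) (z := 0) (by simp)
    rw [prod_sub_div_add] at h
    have h' : c 0 ^ 2 * (2 / (((k : ℝ) + 1) ^ 2 * ((k : ℝ) + 2) ^ 2)) ≤
        cauchyForm (fun i : ℕ => (i : ℝ) + 1) c (insert 0 (Finset.Ico 1 (k + 1))) := by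
      refine le_trans (le_of_eq ?_) h
      push_cast
      field_simp
      ring
    nlinarith [mul_le_mul_of_nonneg_left h' (by positivity : 0 ≤ 3 * x),
      mul_nonneg (sq_nonneg (c 0)) hk]
  · let a : ℕ → ℝ := fun i => if 0 ≤ m + i then ((m : ℝ) + 2) / 2 + i else 1
    have ha : ∀ i, 0 < a i := by
      intro i
      simp only [a]
      split_ifs with h
      · have h1 : (0 : ℝ) ≤ m + i := by exact_mod_cast h
        have h2 : (0 : ℝ) ≤ i := i.cast_nonneg
        linarith
      · exact one_pos
    have heq : ∑ i ∈ Finset.range (k + 1), ∑ j ∈ Finset.range (k + 1),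
        moment x (m + i + j) * (c i * c j) = 3 * x * cauchyForm a c (Finset.range (k + 1)) := by
      simp only [cauchyForm, Finset.mul_sum]
      refine Finset.sum_congr rfl fun i _ => Finset.sum_congr rfl fun j _ => ?_
      by_cases hi : 0 ≤ m + i
      · by_cases hj : 0 ≤ m + j
        · have h0 : m + i + j ≠ 0 := by omega
          simp only [moment, h0, a, hi, hj, if_true, if_false]
          push_cast
          rw [show ((m : ℝ) + 2) / 2 + i + ((m + 2) / 2 + j) = m + i + j + 2 by ring]
          ring
        · simp [hc j (not_le.1 hj)]
      · simp [hc i (not_le.1 hi)]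
    rw [heq]
    have := cauchyForm_nonneg ha c (Finset.range (k + 1))
    positivity

end Moments

section Operator

open Finset

theorem inner_adjoint_pow (T : E →L[ℂ] E) (n : ℕ) (u v : E) :
    inner ℂ u ((adjoint T ^ n) v) = inner ℂ ((T ^ n) u) v := by
  rw [← star_eq_adjoint, ← star_pow, star_eq_adjoint, adjoint_inner_right]

theorem inner_pow_apply (T : E →L[ℂ] E) (n : ℕ) (u v : E) :
    inner ℂ u ((T ^ n) v) = inner ℂ ((adjoint T ^ n) u) v := by
  rw [← star_eq_adjoint, ← star_pow, star_eq_adjoint, adjoint_inner_left]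

/-- The Bram–Halmos form equals the commutator form plus a square. -/
theorem bramHalmos_eq (T : E →L[ℂ] E) (k : ℕ) (y : ℕ → E) :
    ∑ i ∈ range (k + 1), ∑ j ∈ range (k + 1), inner ℂ ((T ^ j) (y i)) ((T ^ i) (y j)) =
      (∑ i ∈ range k, ∑ j ∈ range k, inner ℂ (y (i + 1))
        ((adjoint T ^ (j + 1) * T ^ (i + 1) - T ^ (i + 1) * adjoint T ^ (j + 1)) (y (j + 1)))) +
      ((‖y 0 + ∑ j ∈ range k, (adjoint T ^ (j + 1)) (y (j + 1))‖ ^ 2 : ℝ) : ℂ) := by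
  have hsq : ∀ v : E, ((‖v‖ ^ 2 : ℝ) : ℂ) = inner ℂ v v := fun v => by
    rw [inner_self_eq_norm_sq_to_K]
    push_cast
    rfl
  have hterm : ∀ (i j : ℕ) (u v : E),
      (inner ℂ u ((adjoint T ^ j * T ^ i - T ^ i * adjoint T ^ j) v) : ℂ) =
        inner ℂ ((T ^ j) u) ((T ^ i) v) - inner ℂ ((adjoint T ^ i) u) ((adjoint T ^ j) v) := by
    intro i j u v
    rw [sub_apply, inner_sub_right, mul_apply_eq_comp, mul_apply_eq_comp, inner_adjoint_pow,
      inner_pow_apply T i u]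
  rw [hsq]
  set S := ∑ j ∈ range k, (adjoint T ^ (j + 1)) (y (j + 1)) with hS
  have hSS : ∑ i ∈ range k, ∑ j ∈ range k, (inner ℂ ((adjoint T ^ (i + 1)) (y (i + 1)))
      ((adjoint T ^ (j + 1)) (y (j + 1))) : ℂ) = inner ℂ S S := by
    simp only [hS, sum_inner, inner_sum]
    exact sum_comm
  have hl : ∑ j ∈ range k, (inner ℂ ((T ^ (j + 1)) (y 0)) (y (j + 1)) : ℂ) = inner ℂ (y 0) S := by
    simp only [hS, inner_sum, inner_adjoint_pow]
  have hr : ∑ i ∈ range k, (inner ℂ (y (i + 1)) ((T ^ (i + 1)) (y 0)) : ℂ) = inner ℂ S (y 0) := by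
    simp only [hS, sum_inner, ← inner_pow_apply]
  simp only [hterm, sum_sub_distrib, inner_add_left, inner_add_right, hSS]
  rw [sum_range_succ']
  simp only [sum_range_succ' _ k, sum_add_distrib, pow_zero, one_apply_eq_self, hl, hr]
  ring

theorem kHyponormal_iff_bramHalmos (k : ℕ) (T : E →L[ℂ] E) :
    KHyponormal k T ↔ ∀ y : ℕ → E, 0 ≤ (∑ i ∈ range (k + 1), ∑ j ∈ range (k + 1),
      (inner ℂ ((T ^ j) (y i)) ((T ^ i) (y j)) : ℂ)).re := by
  constructor
  · intro h y
    have h1 := (Complex.nonneg_iff.1 (h fun i => y (i + 1))).1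
    rw [bramHalmos_eq, Complex.add_re, Complex.ofReal_re, sum_range]
    simp only [sum_range]
    positivity
  · intro h x
    let z : ℕ → E := fun i => if hi : i < k then x ⟨i, hi⟩ else 0
    let y : ℕ → E := fun i => Nat.casesOn i (-∑ j ∈ range k, (adjoint T ^ (j + 1)) (z j)) z
    have hy := bramHalmos_eq T k y
    have hyz : ∀ i : Fin k, y (i + 1) = x i := fun i => by simp [y, z]
    have h0 : y 0 + ∑ j ∈ range k, (adjoint T ^ (j + 1)) (y (j + 1)) = 0 := by simp [y]
    rw [h0, norm_zero, sum_range (n := k)] at hy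
    simp only [sum_range (n := k), hyz] at hy
    rw [zero_pow two_ne_zero, Complex.ofReal_zero, add_zero] at hy
    have him : (starRingEnd ℂ) (∑ i ∈ range (k + 1), ∑ j ∈ range (k + 1),
        (inner ℂ ((T ^ j) (y i)) ((T ^ i) (y j)) : ℂ)) = ∑ i ∈ range (k + 1),
          ∑ j ∈ range (k + 1), (inner ℂ ((T ^ j) (y i)) ((T ^ i) (y j)) : ℂ) := by
      simp only [map_sum, inner_conj_symm]
      exact sum_comm
    have hre := h y
    have him' := Complex.conj_eq_iff_im.1 him
    rw [hy] at hre him'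
    exact Complex.nonneg_iff.2 ⟨hre, him'.symm⟩

end Operator

section Shift

open Finset

/-- Coordinates of `u`, extended by zero to `ℤ` and divided by the square roots of the moments. -/
def normCoord (x : ℝ) (u : H) (n : ℤ) : ℂ :=
  if 0 ≤ n then u n.toNat / (√(moment x n) : ℝ) else 0

theorem normCoord_of_neg (x : ℝ) (u : H) {n : ℤ} (hn : n < 0) : normCoord x u n = 0 :=
  if_neg (not_le.2 hn)

theorem IsWeightedShift.hasSum_apply {α : ℕ → ℝ} {W : H →L[ℂ] H} (hW : IsWeightedShift α W)
    (u : H) (n : ℕ) : HasSum (fun m => u m * (α m * e (m + 1) n)) (W u n) := by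
  have h1 := (lp.hasSum_single (p := 2) ENNReal.ofNat_ne_top u).mapL W
  have h2 := h1.mapL (lp.evalCLM ℂ (fun _ : ℕ => ℂ) 2 n)
  refine HasSum.congr_fun h2 fun m => Eq.symm ?_
  have : lp.single 2 m (u m) = u m • e m := by
    rw [e, ← lp.single_smul]
    simp
  rw [this, map_smul, hW m]
  rfl

theorem e_apply (m n : ℕ) : e m n = if n = m then 1 else 0 := by
  simp [e, lp.single_apply, Pi.single_apply]

theorem IsWeightedShift.apply_zero {α : ℕ → ℝ} {W : H →L[ℂ] H} (hW : IsWeightedShift α W)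
    (u : H) : W u 0 = 0 := by
  refine (hW.hasSum_apply u 0).unique ?_
  simp [e_apply, hasSum_zero]

theorem IsWeightedShift.apply_succ {α : ℕ → ℝ} {W : H →L[ℂ] H} (hW : IsWeightedShift α W)
    (u : H) (n : ℕ) : W u (n + 1) = α n * u n := by
  refine (hW.hasSum_apply u (n + 1)).unique ?_
  convert hasSum_single n ?_ using 1
  · simp [e_apply, mul_comm]
  · intro m hm
    simp [e_apply, hm.symm]

variable {x : ℝ} {W : H →L[ℂ] H}

theorem normCoord_shift (hx : 0 < x) (hW : IsWeightedShift (alphaX x) W) (u : H) (n : ℤ) :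
    normCoord x (W u) n = normCoord x u (n - 1) := by
  rcases lt_trichotomy n 0 with hn | rfl | hn
  · rw [normCoord_of_neg x _ hn, normCoord_of_neg x _ (by omega)]
  · rw [normCoord_of_neg x u (by omega)]
    simp [normCoord, hW.apply_zero]
  · obtain ⟨m, rfl⟩ : ∃ m : ℕ, n = (m : ℤ) + 1 := ⟨(n - 1).toNat, by omega⟩
    have h1 : (0 : ℤ) ≤ (m : ℤ) + 1 := by omega
    have h2 : ((m : ℤ) + 1).toNat = m + 1 := by omega
    have hs := sqrt_moment_succ hx m
    have hpos : 0 < √(moment x ((m : ℤ) + 1)) := Real.sqrt_pos.2 (moment_pos hx h1)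
    rw [hs] at hpos
    have hα : ((alphaX x m : ℝ) : ℂ) ≠ 0 := by
      exact_mod_cast left_ne_zero_of_mul hpos.ne'
    rw [normCoord, normCoord, if_pos h1, add_sub_cancel_right, if_pos (by omega), h2,
      hW.apply_succ, hs, Complex.ofReal_mul, mul_div_mul_left _ _ hα, Int.toNat_natCast]

theorem normCoord_shift_pow (hx : 0 < x) (hW : IsWeightedShift (alphaX x) W) (u : H) (j : ℕ)
    (n : ℤ) : normCoord x ((W ^ j) u) n = normCoord x u (n - j) := by
  induction j generalizing n with
  | zero => simp
  | succ j ih =>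
    rw [pow_succ', mul_apply_eq_comp, normCoord_shift hx hW, ih]
    congr 1
    push_cast
    ring

theorem hasSum_inner_normCoord (hx : 0 < x) (u v : H) :
    HasSum (fun n : ℤ => (moment x n : ℂ) * (starRingEnd ℂ (normCoord x u n) * normCoord x v n))
      (inner ℂ u v) := by
  have hinj : Function.Injective ((↑) : ℕ → ℤ) := Nat.cast_injective
  rw [← hinj.hasSum_iff]
  · refine HasSum.congr_fun (lp.hasSum_inner u v) fun n => Eq.symm ?_
    have hpos := moment_pos hx (Int.natCast_nonneg n)
    have h : ((√(moment x n) : ℝ) : ℂ) ≠ 0 := by exact_mod_cast (Real.sqrt_pos.2 hpos).ne'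
    have h2 : (moment x n : ℂ) = (√(moment x n) : ℝ) * (√(moment x n) : ℝ) := by
      rw [← Complex.ofReal_mul, Real.mul_self_sqrt hpos.le]
    simp only [Function.comp, normCoord, Int.natCast_nonneg, if_true, Int.toNat_natCast,
      map_div₀, Complex.conj_ofReal, RCLike.inner_apply]
    rw [h2]
    field_simp
  · intro n hn
    rw [normCoord_of_neg]
    · simp
    · by_contra h
      exact hn ⟨n.toNat, by simp; omega⟩

theorem hasSum_inner_shift_pow (hx : 0 < x) (hW : IsWeightedShift (alphaX x) W) (u v : H)
    (i j : ℕ) :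
    HasSum (fun m : ℤ => (moment x (m + i + j) : ℂ) *
      (starRingEnd ℂ (normCoord x u (m + i)) * normCoord x v (m + j)))
      (inner ℂ ((W ^ j) u) ((W ^ i) v)) := by
  have h := hasSum_inner_normCoord hx ((W ^ j) u) ((W ^ i) v)
  rw [← (Equiv.addRight ((i : ℤ) + j)).hasSum_iff] at h
  convert h using 1
  funext m
  simp only [Function.comp, Equiv.coe_addRight, normCoord_shift_pow hx hW]
  rw [← add_assoc, add_sub_cancel_right, add_right_comm m, add_sub_cancel_right,
    add_right_comm m]

theorem hasSum_re_bramHalmos (hx : 0 < x) (hW : IsWeightedShift (alphaX x) W) (k : ℕ)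
    (y : ℕ → H) :
    HasSum (fun m : ℤ => ∑ i ∈ range (k + 1), ∑ j ∈ range (k + 1), moment x (m + i + j) *
        ((normCoord x (y i) (m + i)).re * (normCoord x (y j) (m + j)).re +
          (normCoord x (y i) (m + i)).im * (normCoord x (y j) (m + j)).im))
      (∑ i ∈ range (k + 1), ∑ j ∈ range (k + 1),
        (inner ℂ ((W ^ j) (y i)) ((W ^ i) (y j)) : ℂ)).re := by
  have h := Complex.hasSum_re (hasSum_sum fun i (_ : i ∈ range (k + 1)) =>
    hasSum_sum fun j (_ : j ∈ range (k + 1)) => hasSum_inner_shift_pow hx hW (y i) (y j) i j)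
  convert h using 2 with m
  simp [Complex.re_sum]

theorem kHyponormal_iff_rank_one (hx : 0 < x) (hW : IsWeightedShift (alphaX x) W) (k : ℕ) :
    KHyponormal k W ↔
      0 ≤ 3 * x * (2 / (((k : ℝ) + 1) ^ 2 * ((k : ℝ) + 2) ^ 2)) + (1 - 3 * x / 2) := by
  rw [kHyponormal_iff_bramHalmos]
  constructor
  · intro h
    obtain ⟨c, hc0, hc⟩ := exists_cauchyForm_insert_eq (a := fun i : ℕ => (i : ℝ) + 1)
      (fun i => by positivity) (fun i j hij => by simpa using hij)
      (S := Ico 1 (k + 1)) (z := 0) (by simp)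
    let y : ℕ → H := fun i => ((c i * √(moment x i) : ℝ) : ℂ) • e i
    have hy : ∀ (i : ℕ) (m : ℤ), normCoord x (y i) (m + i) = if m = 0 then (c i : ℂ) else 0 := by
      intro i m
      have hpos := Real.sqrt_pos.2 (moment_pos hx (Int.natCast_nonneg i))
      have hne : ((√(moment x i) : ℝ) : ℂ) ≠ 0 := by exact_mod_cast hpos.ne'
      by_cases hm : m = 0
      · simp [normCoord, hm, y, e_apply, hne]
      · by_cases hn : 0 ≤ m + i
        · have : (m + i).toNat ≠ i := by omega
          simp [normCoord, hm, y, e_apply, this]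
        · simp [normCoord, hm, hn]
    have h1 := hasSum_re_bramHalmos hx hW k y
    have h2 := h y
    rw [h1.unique (hasSum_single 0 fun m hm => by simp [hy, hm])] at h2
    simp only [hy, if_true, Complex.ofReal_re, Complex.ofReal_im, mul_zero, add_zero] at h2
    rw [sum_moment_zero, hc, hc0, prod_sub_div_add] at h2
    convert h2 using 2
    · push_cast
      field_simp
      ring
    · ring
  · intro hk y
    refine (hasSum_re_bramHalmos hx hW k y).nonneg fun m => ?_
    simp only [mul_add, sum_add_distrib]
    refine add_nonneg (sum_moment_nonneg hx hk m (fun i => (normCoord x (y i) (m + i)).re) ?_)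
      (sum_moment_nonneg hx hk m (fun i => (normCoord x (y i) (m + i)).im) ?_)
    all_goals
      intro i hi
      simp [normCoord_of_neg x _ hi]

end Shift

/-- `W_{α(x)}` is `k`-hyponormal iff `0 < x ≤ 2(k+1)²(k+2)²/(3k(k+3)(k²+3k+4))`. -/
theorem kHyponormal_iff (x : ℝ) (hx : 0 < x) (k : ℕ) (hk : 1 ≤ k)
    (W : H →L[ℂ] H) (hW : IsWeightedShift (alphaX x) W) :
    KHyponormal k W ↔
      (0 < x ∧ x ≤ 2 * ((k : ℝ) + 1) ^ 2 * ((k : ℝ) + 2) ^ 2 /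
        (3 * (k : ℝ) * ((k : ℝ) + 3) * ((k : ℝ) ^ 2 + 3 * (k : ℝ) + 4))) := by
  have hk' : (0 : ℝ) < k := by exact_mod_cast hk
  rw [kHyponormal_iff_rank_one hx hW, le_div_iff₀ (by positivity)]
  have h : 3 * x * (2 / (((k : ℝ) + 1) ^ 2 * ((k : ℝ) + 2) ^ 2)) + (1 - 3 * x / 2) =
      (2 * ((k : ℝ) + 1) ^ 2 * ((k : ℝ) + 2) ^ 2 -
        x * (3 * (k : ℝ) * ((k : ℝ) + 3) * ((k : ℝ) ^ 2 + 3 * (k : ℝ) + 4))) /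
        (2 * (((k : ℝ) + 1) ^ 2 * ((k : ℝ) + 2) ^ 2)) := by
    field_simp
    ring
  rw [h, le_div_iff₀ (by positivity), zero_mul, sub_nonneg]
  exact ⟨fun h => ⟨hx, h⟩, fun h => h.2⟩
end
end

section
/- For x > 0, let α(x) be the weight sequence α_0 := √x and α_n := √((n+2)/(n+3)) for n ≥ 1, and let W_{α(x)} be the associated unilateral weighted shift on ℓ²(ℕ, ℂ). If 200/297 < x ≤ 667/990, then W_{α(x)} is quartically hyponormal but not 3-hyponormal. -/
open scoped ComplexOrder
open ContinuousLinearMap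

noncomputable section

variable {E : Type*} [NormedAddCommGroup E] [InnerProductSpace ℂ E] [CompleteSpace E]

theorem cauchy_form_nonneg (s : ℕ) (w : Fin 4 → ℝ) :
    0 ≤ ∑ i : Fin 4, ∑ j : Fin 4, w i * w j / ((s : ℝ) + i + j + 1) := by
  have h : ∑ i : Fin 4, ∑ j : Fin 4, w i * w j / ((s : ℝ) + i + j + 1) =
      ∫ t in (0 : ℝ)..1, t ^ s * (∑ i : Fin 4, w i * t ^ (i : ℕ)) ^ 2 := by
    have h2 : ∀ t : ℝ, t ^ s * (∑ i : Fin 4, w i * t ^ (i : ℕ)) ^ 2 =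
        ∑ i : Fin 4, ∑ j : Fin 4, w i * w j * t ^ (s + i + j) := by
      intro t
      rw [sq, Finset.sum_mul_sum, Finset.mul_sum]
      refine Finset.sum_congr rfl fun i _ => ?_
      rw [Finset.mul_sum]
      refine Finset.sum_congr rfl fun j _ => ?_
      ring
    simp_rw [h2]
    rw [intervalIntegral.integral_finsetSum fun i _ => by
      apply Continuous.intervalIntegrable; fun_prop]
    refine Finset.sum_congr rfl fun i _ => ?_
    rw [intervalIntegral.integral_finsetSum fun j _ => by
      apply Continuous.intervalIntegrable; fun_prop]
    refine Finset.sum_congr rfl fun j _ => ?_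
    rw [intervalIntegral.integral_const_mul, integral_pow]
    push_cast
    simp [div_eq_mul_inv]
  rw [h]
  exact intervalIntegral.integral_nonneg zero_le_one fun t ht =>
    mul_nonneg (pow_nonneg ht.1 s) (sq_nonneg _)

theorem form_neg_one_nonneg (a b c d : ℝ) :
    0 ≤ a * a / 3 + a * b / 2 + 2 * a * c / 5 + a * d / 3 + b * b / 5 + b * c / 3
      + 2 * b * d / 7 + c * c / 7 + c * d / 4 + d * d / 9 - 64 * (b * b) / 2268000 := by
  linarith [sq_nonneg (3 / 2 * a + 9 / 7 * b + 9 / 8 * c + d),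
    sq_nonneg (a + 3 / 7 * b + 3 / 20 * c), sq_nonneg (5 / 3 * b + c), sq_nonneg b]

theorem form_zero_nonneg (x : ℝ) (hx : x ≤ 667 / 990) (a b c d : ℝ) :
    0 ≤ a * a / 4 + 2 * a * b / 5 + 2 * a * c / 6 + 2 * a * d / 7 + b * b / 6 + 2 * b * c / 7
      + 2 * b * d / 8 + c * c / 8 + 2 * c * d / 9 + d * d / 10
      - 3 * x * (a / 3 + b / 4 + c / 5 + d / 6) ^ 2 - 48 * (a * b) / 2268000 := by
  have h := mul_nonneg (sub_nonneg.2 hx) (sq_nonneg (a / 3 + b / 4 + c / 5 + d / 6))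
  linarith [sq_nonneg (2542 / 3647 * a + 969 / 1042 * b + 2598 / 2605 * c + d),
    sq_nonneg (47060 / 17451 * a + 12290 / 5817 * b + c), sq_nonneg (892 / 375 * a + b),
    sq_nonneg a]

theorem form_one_nonneg (a b c d : ℝ) :
    0 ≤ a * a / 80 + 2 * (2 * a * b / 120) + 2 * (3 * a * c / 168) + 2 * (4 * a * d / 224)
      + 4 * (b * b) / 175 + 2 * (6 * b * c / 240) + 2 * (8 * b * d / 315) + 9 * (c * c) / 324
      + 2 * (12 * c * d / 420) + 16 * (d * d) / 539 - 9 * (a * a) / 2268000 := by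
  linarith [sq_nonneg (9 / 14 * a + 9 / 10 * b + c + 36 / 35 * d),
    sq_nonneg (5 / 3 * a + b - 8 / 9 * d), sq_nonneg (a + 100 / 129 * d), sq_nonneg d]
/-- The coordinates of `y` with respect to the orthogonal family `√(γ n) • e n`, extended by zero to
negative indices. -/
def coord (γ : ℤ → ℝ) (y : H) (n : ℤ) : ℂ :=
  if 0 ≤ n then y n.toNat / (Real.sqrt (γ n) : ℂ) else 0

/-- The matrix entries of the commutator `[W* ^ j, W ^ i]` on the `k`-th diagonal, where `W` is the
weighted shift with moments `γ`. -/
def commutatorCoeff (γ : ℤ → ℝ) (k i j : ℤ) : ℝ :=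
  γ (k + i + j) - if 0 ≤ k then γ (k + i) * γ (k + j) / γ k else 0

theorem coord_of_neg (γ : ℤ → ℝ) (y : H) {n : ℤ} (hn : n < 0) : coord γ y n = 0 :=
  if_neg hn.not_ge

theorem coord_natCast (γ : ℤ → ℝ) (y : H) (n : ℕ) :
    coord γ y n = y n / (Real.sqrt (γ n) : ℂ) := by
  simp [coord]

theorem coord_smul (γ : ℤ → ℝ) (a : ℂ) (y : H) (n : ℤ) :
    coord γ (a • y) n = a * coord γ y n := by
  unfold coord
  split_ifs <;> simp [mul_div_assoc]

theorem coord_e (γ : ℤ → ℝ) (m : ℕ) (n : ℤ) :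
    coord γ (e m) n = if n = m then 1 / (Real.sqrt (γ n) : ℂ) else 0 := by
  rcases lt_or_ge n 0 with hn | hn
  · rw [coord_of_neg _ _ hn, if_neg (by lia)]
  · lift n to ℕ using hn
    rw [coord_natCast]
    by_cases h : n = m
    · subst h; simp [e]
    · simp [e, h]

theorem hasSum_inner_coord {γ : ℤ → ℝ} (hγ : ∀ n, 0 < γ n) (y z : H) :
    HasSum (fun n : ℤ => (γ n : ℂ) * ((starRingEnd ℂ) (coord γ y n) * coord γ z n))
      (inner ℂ y z) := by
  refine (Function.Injective.hasSum_iff Nat.cast_injective ?_).1 ?_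
  · intro n hn
    rw [coord_of_neg γ z, mul_zero, mul_zero]
    by_contra! h
    exact hn ⟨n.toNat, Int.toNat_of_nonneg h⟩
  · suffices h : (fun n : ℕ => inner ℂ (y n) (z n)) = (fun n : ℤ => (γ n : ℂ) *
        ((starRingEnd ℂ) (coord γ y n) * coord γ z n)) ∘ ((↑) : ℕ → ℤ) from
      h ▸ lp.hasSum_inner y z
    funext n
    have h : ((Real.sqrt (γ n) : ℝ) : ℂ) ≠ 0 := by
      exact_mod_cast (Real.sqrt_pos.2 (hγ n)).ne'
    have h2 : (γ n : ℂ) = Real.sqrt (γ n) * Real.sqrt (γ n) := by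
      exact_mod_cast (Real.mul_self_sqrt (hγ n).le).symm
    simp only [Function.comp, coord_natCast, map_div₀, Complex.conj_ofReal, RCLike.inner_apply]
    rw [h2]
    field_simp

section WeightedShift

variable {γ : ℤ → ℝ} {α : ℕ → ℝ} {W : H →L[ℂ] H}

theorem adjoint_weightedShift_apply (hW : IsWeightedShift α W) (y : H) (n : ℕ) :
    adjoint W y n = α n * y (n + 1) := by
  have h1 : ∀ (m : ℕ) (z : H), inner ℂ (e m) z = z m := fun m z => by
    simp [e, lp.inner_single_left]
  rw [← h1, adjoint_inner_right, hW n, inner_smul_left, h1, Complex.conj_ofReal]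

theorem weightedShift_apply_zero (hW : IsWeightedShift α W) (y : H) : W y 0 = 0 := by
  have h1 : inner ℂ (e 0) (W y) = W y 0 := by simp [e, lp.inner_single_left]
  have h2 : adjoint W (e 0) = 0 := by
    ext n
    rw [adjoint_weightedShift_apply hW]
    simp [e]
  rw [← h1, ← adjoint_inner_left, h2, inner_zero_left]

theorem weightedShift_apply_succ (hW : IsWeightedShift α W) (y : H) (n : ℕ) :
    W y (n + 1) = α n * y n := by
  have h1 : ∀ (m : ℕ) (z : H), inner ℂ (e m) z = z m := fun m z => by
    simp [e, lp.inner_single_left]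
  have h2 : adjoint W (e (n + 1)) = (α n : ℂ) • e n := by
    ext m
    change adjoint W (e (n + 1)) m = (α n : ℂ) * e n m
    rw [adjoint_weightedShift_apply hW]
    by_cases h : m = n
    · subst h; simp [e]
    · simp [e, h]
  rw [← h1, ← adjoint_inner_left, h2, inner_smul_left, h1, Complex.conj_ofReal]

theorem coord_weightedShift (hγ : ∀ n, 0 < γ n)
    (hα : ∀ n : ℕ, α n = Real.sqrt (γ (n + 1)) / Real.sqrt (γ n)) (hW : IsWeightedShift α W)
    (y : H) (n : ℤ) : coord γ (W y) n = coord γ y (n - 1) := by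
  rcases lt_or_ge n 0 with hn | hn
  · rw [coord_of_neg _ _ hn, coord_of_neg _ _ (by lia)]
  · lift n to ℕ using hn
    rcases n with _ | n
    · rw [coord_natCast, weightedShift_apply_zero hW, zero_div, coord_of_neg _ _ (by lia)]
    · have h1 : ((Real.sqrt (γ n) : ℝ) : ℂ) ≠ 0 := by
        exact_mod_cast (Real.sqrt_pos.2 (hγ n)).ne'
      have h2 : ((Real.sqrt (γ (n + 1)) : ℝ) : ℂ) ≠ 0 := by
        exact_mod_cast (Real.sqrt_pos.2 (hγ (n + 1))).ne'
      rw [show ((n + 1 : ℕ) : ℤ) - 1 = (n : ℤ) by lia, coord_natCast, coord_natCast,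
        weightedShift_apply_succ hW, hα]
      push_cast
      field_simp

theorem coord_weightedShift_pow (hγ : ∀ n, 0 < γ n)
    (hα : ∀ n : ℕ, α n = Real.sqrt (γ (n + 1)) / Real.sqrt (γ n)) (hW : IsWeightedShift α W)
    (i : ℕ) (y : H) (n : ℤ) : coord γ ((W ^ i) y) n = coord γ y (n - i) := by
  induction i generalizing n with
  | zero => simp
  | succ i ih =>
    rw [pow_succ', mul_apply_eq_comp, coord_weightedShift hγ hα hW, ih]
    congr 1
    push_cast
    ring

theorem coord_adjoint_weightedShift (hγ : ∀ n, 0 < γ n)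
    (hα : ∀ n : ℕ, α n = Real.sqrt (γ (n + 1)) / Real.sqrt (γ n)) (hW : IsWeightedShift α W)
    (y : H) {n : ℤ} (hn : 0 ≤ n) :
    (γ n : ℂ) * coord γ (adjoint W y) n = γ (n + 1) * coord γ y (n + 1) := by
  lift n to ℕ using hn
  have h1 : ((Real.sqrt (γ n) : ℝ) : ℂ) ≠ 0 := by
    exact_mod_cast (Real.sqrt_pos.2 (hγ n)).ne'
  have h2 : ((Real.sqrt (γ (n + 1)) : ℝ) : ℂ) ≠ 0 := by
    exact_mod_cast (Real.sqrt_pos.2 (hγ (n + 1))).ne'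
  have h3 : (γ n : ℂ) = Real.sqrt (γ n) * Real.sqrt (γ n) := by
    exact_mod_cast (Real.mul_self_sqrt (hγ n).le).symm
  have h4 : (γ (n + 1) : ℂ) = Real.sqrt (γ (n + 1)) * Real.sqrt (γ (n + 1)) := by
    exact_mod_cast (Real.mul_self_sqrt (hγ (n + 1)).le).symm
  rw [show (n : ℤ) + 1 = ((n + 1 : ℕ) : ℤ) by lia, coord_natCast, coord_natCast,
    adjoint_weightedShift_apply hW, hα, show ((n + 1 : ℕ) : ℤ) = (n : ℤ) + 1 by lia, h3, h4]
  push_cast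
  field_simp

theorem coord_adjoint_weightedShift_pow (hγ : ∀ n, 0 < γ n)
    (hα : ∀ n : ℕ, α n = Real.sqrt (γ (n + 1)) / Real.sqrt (γ n)) (hW : IsWeightedShift α W)
    (i : ℕ) (y : H) {n : ℤ} (hn : 0 ≤ n) :
    (γ n : ℂ) * coord γ ((adjoint W ^ i) y) n = γ (n + i) * coord γ y (n + i) := by
  induction i generalizing n with
  | zero => simp
  | succ i ih =>
    rw [pow_succ', mul_apply_eq_comp, coord_adjoint_weightedShift hγ hα hW _ hn,
      ih (by lia), show n + 1 + (i : ℤ) = n + ((i + 1 : ℕ) : ℤ) by push_cast; ring]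

theorem hasSum_inner_commutator (hγ : ∀ n, 0 < γ n)
    (hα : ∀ n : ℕ, α n = Real.sqrt (γ (n + 1)) / Real.sqrt (γ n)) (hW : IsWeightedShift α W)
    (i j : ℕ) (y z : H) :
    HasSum (fun k : ℤ => (commutatorCoeff γ k i j : ℂ) *
        ((starRingEnd ℂ) (coord γ y (k + i)) * coord γ z (k + j)))
      (inner ℂ y ((adjoint W ^ j * W ^ i - W ^ i * adjoint W ^ j) z)) := by
  have hadj : ∀ m : ℕ, adjoint (W ^ m) = adjoint W ^ m := fun m => by
    simpa only [ContinuousLinearMap.star_eq_adjoint] using star_pow W m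
  have h1 : HasSum (fun k : ℤ => (γ (k + i + j) : ℂ) *
      ((starRingEnd ℂ) (coord γ y (k + i)) * coord γ z (k + j)))
      (inner ℂ ((W ^ j) y) ((W ^ i) z)) := by
    have h := (Equiv.addRight ((i : ℤ) + j)).hasSum_iff.2
      (hasSum_inner_coord hγ ((W ^ j) y) ((W ^ i) z))
    convert h using 2 with k
    simp only [Function.comp, Equiv.coe_addRight, coord_weightedShift_pow hγ hα hW]
    rw [show k + ((i : ℤ) + j) - j = k + i by ring, show k + ((i : ℤ) + j) - i = k + j by ring,
      add_assoc]
  have h2 : HasSum (fun k : ℤ =>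
      ((if 0 ≤ k then γ (k + i) * γ (k + j) / γ k else 0 : ℝ) : ℂ) *
      ((starRingEnd ℂ) (coord γ y (k + i)) * coord γ z (k + j)))
      (inner ℂ ((adjoint W ^ i) y) ((adjoint W ^ j) z)) := by
    have h := hasSum_inner_coord hγ ((adjoint W ^ i) y) ((adjoint W ^ j) z)
    convert h using 2 with k
    split_ifs with hk
    · have hk' : (γ k : ℂ) ≠ 0 := by exact_mod_cast (hγ k).ne'
      have e1 := coord_adjoint_weightedShift_pow hγ hα hW i y hk
      have e2 := coord_adjoint_weightedShift_pow hγ hα hW j z hk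
      have e3 := congrArg (starRingEnd ℂ) e1
      simp only [map_mul, Complex.conj_ofReal] at e3
      rw [Complex.ofReal_div, Complex.ofReal_mul, div_mul_eq_mul_div, div_eq_iff hk']
      calc _ = (γ (k + i) * (starRingEnd ℂ) (coord γ y (k + i))) *
            (γ (k + j) * coord γ z (k + j)) := by ring
        _ = _ := by
          rw [← e2, ← e3]
          ring
    · rw [coord_of_neg γ ((adjoint W ^ j) z) (by lia)]
      simp
  rw [sub_apply, inner_sub_right, mul_apply_eq_comp, mul_apply_eq_comp,
    ← hadj j, ← adjoint_inner_left (W ^ i), hadj i, adjoint_inner_right, hadj j]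
  simpa only [commutatorCoeff, Complex.ofReal_sub, sub_mul] using h1.sub h2

end WeightedShift

theorem weaklyKHyponormal_of_forall {k : ℕ} {T : E →L[ℂ] E}
    (h : ∀ (lam : Fin k → ℂ) (y : E), 0 ≤ (∑ i, ∑ j, (inner ℂ ((starRingEnd ℂ) (lam i) • y)
      ((adjoint T ^ (j.1 + 1) * T ^ (i.1 + 1) - T ^ (i.1 + 1) * adjoint T ^ (j.1 + 1))
        ((starRingEnd ℂ) (lam j) • y)) : ℂ)).re) :
    WeaklyKHyponormal k T := by
  intro lam y
  have hadj : ∀ m : ℕ, adjoint (T ^ m) = adjoint T ^ m := fun m => by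
    simpa only [ContinuousLinearMap.star_eq_adjoint] using star_pow T m
  have hS : adjoint (∑ j : Fin k, lam j • T ^ (j.1 + 1)) =
      ∑ j : Fin k, (starRingEnd ℂ) (lam j) • adjoint T ^ (j.1 + 1) := by
    simp only [← ContinuousLinearMap.star_eq_adjoint, star_sum, star_smul, star_pow]
    rfl
  refine (sq_le_sq₀ (norm_nonneg _) (norm_nonneg _)).1 ?_
  rw [← sub_nonneg, ← inner_self_eq_norm_sq (𝕜 := ℂ), ← inner_self_eq_norm_sq (𝕜 := ℂ), hS,
    ← map_sub]
  refine (h lam y).trans_eq (congrArg (RCLike.re : ℂ → ℝ) ?_)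
  symm
  simp only [sum_apply, smul_apply, sum_inner, inner_sum,
    inner_smul_left, inner_smul_right, map_smul, sub_apply, inner_sub_right,
    mul_apply_eq_comp, Complex.conj_conj, Finset.mul_sum, mul_sub, Finset.sum_sub_distrib]
  congr 1
  · refine Finset.sum_congr rfl fun i _ => Finset.sum_congr rfl fun j _ => ?_
    rw [← hadj, adjoint_inner_right, mul_left_comm]
  · rw [Finset.sum_comm]
    refine Finset.sum_congr rfl fun i _ => Finset.sum_congr rfl fun j _ => ?_
    rw [← adjoint_inner_left (T ^ _), hadj]

/-- The moments of `W_{α(x)}`, divided by `3 * x`; the value at negative indices is immaterial. -/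
def momentX (x : ℝ) (n : ℤ) : ℝ :=
  if 0 < n then 1 / ((n : ℝ) + 2) else 1 / (3 * x)

theorem momentX_pos {x : ℝ} (hx : 0 < x) (n : ℤ) : 0 < momentX x n := by
  unfold momentX
  split_ifs with h
  · have : (0 : ℝ) < n := by exact_mod_cast h
    positivity
  · positivity

theorem momentX_of_pos (x : ℝ) {n : ℤ} (hn : 0 < n) : momentX x n = 1 / ((n : ℝ) + 2) :=
  if_pos hn

theorem momentX_zero (x : ℝ) : momentX x 0 = 1 / (3 * x) :=
  if_neg (lt_irrefl 0)

theorem alphaX_eq_momentX {x : ℝ} (hx : 0 < x) (n : ℕ) :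
    alphaX x n = Real.sqrt (momentX x (n + 1)) / Real.sqrt (momentX x n) := by
  rw [← Real.sqrt_div (momentX_pos hx _).le, momentX_of_pos x (by lia : (0 : ℤ) < n + 1), alphaX]
  rcases n with _ | n
  · rw [if_pos rfl, Nat.cast_zero, momentX_zero]
    congr 1
    push_cast
    field_simp
    norm_num
  · rw [if_neg (by lia), momentX_of_pos x (by lia : (0 : ℤ) < (n + 1 : ℕ))]
    congr 1
    push_cast
    field_simp
    ring

/-- The quadratic form of the `k`-th diagonal block of the commutators of `W ^ 1, …, W ^ 4`. -/
def blockForm (x : ℝ) (k : ℤ) (v : Fin 4 → ℝ) : ℝ :=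
  ∑ i : Fin 4, ∑ j : Fin 4,
    commutatorCoeff (momentX x) k (i.1 + 1 : ℕ) (j.1 + 1 : ℕ) * (v i * v j)

theorem commutatorCoeff_momentX_of_pos (x : ℝ) {k i j : ℤ} (hk : 0 < k) (hi : 0 < i)
    (hj : 0 < j) : commutatorCoeff (momentX x) k i j =
      (i : ℝ) * j / (((k : ℝ) + 2 + i + j) * ((k : ℝ) + 2 + i) * ((k : ℝ) + 2 + j)) := by
  have hk' : (0 : ℝ) < k := by exact_mod_cast hk
  have hi' : (0 : ℝ) < i := by exact_mod_cast hi
  have hj' : (0 : ℝ) < j := by exact_mod_cast hj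
  rw [commutatorCoeff, if_pos hk.le, momentX_of_pos x hk, momentX_of_pos x (by lia : 0 < k + i),
    momentX_of_pos x (by lia : 0 < k + j), momentX_of_pos x (by lia : 0 < k + i + j)]
  push_cast
  field_simp
  ring

theorem commutatorCoeff_momentX_zero {x : ℝ} {i j : ℤ} (hi : 0 < i) (hj : 0 < j) :
    commutatorCoeff (momentX x) 0 i j =
      1 / ((i : ℝ) + j + 2) - 3 * x / (((i : ℝ) + 2) * ((j : ℝ) + 2)) := by
  rw [commutatorCoeff, if_pos le_rfl, momentX_zero, zero_add, zero_add, momentX_of_pos x hi,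
    momentX_of_pos x hj, momentX_of_pos x (by lia : 0 < i + j)]
  have hi' : (0 : ℝ) < i := by exact_mod_cast hi
  have hj' : (0 : ℝ) < j := by exact_mod_cast hj
  push_cast
  field_simp

theorem commutatorCoeff_momentX_of_neg (x : ℝ) {k i j : ℤ} (hk : k < 0) (h : 0 < k + i + j) :
    commutatorCoeff (momentX x) k i j = 1 / ((k : ℝ) + i + j + 2) := by
  rw [commutatorCoeff, if_neg hk.not_ge, sub_zero, momentX_of_pos x h]
  push_cast
  rfl

theorem blockForm_nonneg_of_pos (x : ℝ) {k : ℤ} (hk : 0 < k) (v : Fin 4 → ℝ) :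
    0 ≤ blockForm x k v := by
  have hk' : (0 : ℝ) < k := by exact_mod_cast hk
  convert cauchy_form_nonneg (k + 3).toNat
    (fun i => ((i : ℝ) + 1) * v i / ((k : ℝ) + 2 + ((i : ℝ) + 1))) using 1
  refine Finset.sum_congr rfl fun i _ => Finset.sum_congr rfl fun j _ => ?_
  rw [commutatorCoeff_momentX_of_pos x hk (by lia) (by lia)]
  have h : ((k + 3).toNat : ℝ) = (k : ℝ) + 3 := by
    exact_mod_cast Int.toNat_of_nonneg (by lia : 0 ≤ k + 3)
  rw [h]
  push_cast
  field_simp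
  ring

theorem blockForm_nonneg_of_neg (x : ℝ) {k : ℤ} (hk : k < 0) (v : Fin 4 → ℝ)
    (hv : ∀ i : Fin 4, k + (i.1 + 1 : ℕ) < 0 → v i = 0) : 0 ≤ blockForm x k v := by
  rcases lt_or_ge k (-4) with h4 | h4
  · have : v = 0 := funext fun i => hv i (by have := i.2; lia)
    simp [blockForm, this]
  obtain rfl | rfl | rfl | rfl : k = -4 ∨ k = -3 ∨ k = -2 ∨ k = -1 := by lia
  · have h0 := hv 0 (by norm_num)
    have h1 := hv 1 (by norm_num)
    have h2 := hv 2 (by norm_num)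
    have h := cauchy_form_nonneg 5 ![v 3, 0, 0, 0]
    simp [Fin.sum_univ_four] at h
    simp [blockForm, Fin.sum_univ_four, h0, h1, h2, commutatorCoeff_momentX_of_neg]
    linarith
  · have h0 := hv 0 (by norm_num)
    have h1 := hv 1 (by norm_num)
    have h := cauchy_form_nonneg 4 ![v 2, v 3, 0, 0]
    simp [Fin.sum_univ_four] at h
    simp [blockForm, Fin.sum_univ_four, h0, h1, commutatorCoeff_momentX_of_neg]
    linarith
  · have h0 := hv 0 (by norm_num)
    have h := cauchy_form_nonneg 3 ![v 1, v 2, v 3, 0]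
    simp [Fin.sum_univ_four] at h
    simp [blockForm, Fin.sum_univ_four, h0, commutatorCoeff_momentX_of_neg]
    linarith
  · have h := cauchy_form_nonneg 2 v
    simp [Fin.sum_univ_four] at h
    simp [blockForm, Fin.sum_univ_four, commutatorCoeff_momentX_of_neg]
    linarith

theorem le_blockForm_neg_one (x : ℝ) (v : Fin 4 → ℝ) :
    64 * (v 1 * v 1) / 2268000 ≤ blockForm x (-1) v := by
  have h := form_neg_one_nonneg (v 0) (v 1) (v 2) (v 3)
  simp [blockForm, Fin.sum_univ_four, commutatorCoeff_momentX_of_neg]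
  linarith

theorem le_blockForm_zero {x : ℝ} (hx : x ≤ 667 / 990) (v : Fin 4 → ℝ) :
    48 * (v 0 * v 1) / 2268000 ≤ blockForm x 0 v := by
  have h := form_zero_nonneg x hx (v 0) (v 1) (v 2) (v 3)
  simp [blockForm, Fin.sum_univ_four, commutatorCoeff_momentX_zero]
  linarith

theorem le_blockForm_one (x : ℝ) (v : Fin 4 → ℝ) :
    9 * (v 0 * v 0) / 2268000 ≤ blockForm x 1 v := by
  have h := form_one_nonneg (v 0) (v 1) (v 2) (v 3)
  simp [blockForm, Fin.sum_univ_four, commutatorCoeff_momentX_of_pos]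
  linarith

theorem blockForm_sum_nonneg {x : ℝ} (hx : x ≤ 667 / 990) (lam : Fin 4 → ℂ) (c : ℤ → ℂ) :
    0 ≤ ∑ k ∈ {-1, 0, 1}, (blockForm x k (fun i => (lam i * c (k + (i.1 + 1 : ℕ))).re) +
      blockForm x k (fun i => (lam i * c (k + (i.1 + 1 : ℕ))).im)) := by
  rw [Finset.sum_insert (by decide), Finset.sum_insert (by decide), Finset.sum_singleton]
  refine le_trans ?_ (add_le_add
    (add_le_add (le_blockForm_neg_one x _) (le_blockForm_neg_one x _)) (add_le_add
    (add_le_add (le_blockForm_zero hx _) (le_blockForm_zero hx _))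
    (add_le_add (le_blockForm_one x _) (le_blockForm_one x _))))
  norm_num [Complex.mul_re, Complex.mul_im]
  generalize lam 0 = a, lam 1 = b, c 1 = s, c 2 = t
  linarith [
    sq_nonneg (3 * (a.re * t.re + a.im * t.im) + 8 * (b.re * s.re + b.im * s.im)),
    sq_nonneg (3 * (a.im * t.re - a.re * t.im) + 8 * (b.im * s.re - b.re * s.im))]

theorem hasSum_blockForm {x : ℝ} (hx : 0 < x) {W : H →L[ℂ] H}
    (hW : IsWeightedShift (alphaX x) W) (lam : Fin 4 → ℂ) (y : H) :
    HasSum (fun k : ℤ =>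
      blockForm x k (fun i => (lam i * coord (momentX x) y (k + (i.1 + 1 : ℕ))).re) +
      blockForm x k (fun i => (lam i * coord (momentX x) y (k + (i.1 + 1 : ℕ))).im))
      (∑ i, ∑ j, (inner ℂ (lam i • y)
        ((adjoint W ^ (j.1 + 1) * W ^ (i.1 + 1) - W ^ (i.1 + 1) * adjoint W ^ (j.1 + 1))
          (lam j • y)) : ℂ)).re := by
  have h := Complex.hasSum_re (hasSum_sum fun i (_ : i ∈ Finset.univ) =>
    hasSum_sum fun j (_ : j ∈ Finset.univ) => hasSum_inner_commutator (momentX_pos hx)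
      (alphaX_eq_momentX hx) hW (i.1 + 1) (j.1 + 1) (lam i • y) (lam j • y))
  convert h using 2 with k
  simp only [blockForm, ← Finset.sum_add_distrib, Complex.re_sum, coord_smul]
  refine Finset.sum_congr rfl fun i _ => Finset.sum_congr rfl fun j _ => ?_
  rw [Complex.re_ofReal_mul, Complex.mul_re (starRingEnd ℂ _), Complex.conj_re, Complex.conj_im]
  ring

theorem weaklyKHyponormal_four {x : ℝ} (hx : 0 < x) (hx' : x ≤ 667 / 990) {W : H →L[ℂ] H}
    (hW : IsWeightedShift (alphaX x) W) : WeaklyKHyponormal 4 W := by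
  refine weaklyKHyponormal_of_forall fun lam y => ?_
  refine (blockForm_sum_nonneg hx' _ _).trans
    (sum_le_hasSum _ (fun k hk => ?_)
      (hasSum_blockForm hx hW (fun i => (starRingEnd ℂ) (lam i)) y))
  rcases lt_or_ge k 0 with h | h
  · refine add_nonneg (blockForm_nonneg_of_neg x h _ fun i hi => ?_)
      (blockForm_nonneg_of_neg x h _ fun i hi => ?_) <;>
    simp only [coord_of_neg _ _ hi, mul_zero, Complex.zero_re, Complex.zero_im]
  · have h' : 0 < k := by
      refine lt_of_le_of_ne h fun h0 => hk ?_
      simp [← h0]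
    exact add_nonneg (blockForm_nonneg_of_pos x h' _) (blockForm_nonneg_of_pos x h' _)

theorem not_kHyponormal_three {x : ℝ} (hx : 200 / 297 < x) {W : H →L[ℂ] H}
    (hW : IsWeightedShift (alphaX x) W) : ¬ KHyponormal 3 W := by
  have hx0 : 0 < x := by linarith
  intro h
  let a : Fin 3 → ℝ := ![-60, 105, -56]
  let y : Fin 3 → H := fun i =>
    ((a i * Real.sqrt (momentX x (i.1 + 1 : ℕ)) : ℝ) : ℂ) • e (i.1 + 1)
  have hy : ∀ (i : Fin 3) (n : ℤ), coord (momentX x) (y i) n =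
      if n = (i.1 + 1 : ℕ) then (a i : ℂ) else 0 := by
    intro i n
    rw [coord_smul, coord_e]
    split_ifs with hn
    · have h1 : ((Real.sqrt (momentX x n) : ℝ) : ℂ) ≠ 0 := by
        exact_mod_cast (Real.sqrt_pos.2 (momentX_pos hx0 n)).ne'
      rw [← hn, Complex.ofReal_mul]
      field_simp
    · exact mul_zero _
  have hsum : ∀ i j : Fin 3, (inner ℂ (y i)
      ((adjoint W ^ (j.1 + 1) * W ^ (i.1 + 1) - W ^ (i.1 + 1) * adjoint W ^ (j.1 + 1)) (y j)) : ℂ)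
      = ((commutatorCoeff (momentX x) 0 (i.1 + 1 : ℕ) (j.1 + 1 : ℕ) * (a i * a j) : ℝ) : ℂ) := by
    intro i j
    have h1 := hasSum_inner_commutator (momentX_pos hx0)
      (alphaX_eq_momentX hx0) hW (i.1 + 1) (j.1 + 1) (y i) (y j)
    refine h1.unique ?_
    convert hasSum_single (0 : ℤ) ?_ using 1
    · simp [hy]
    · intro k hk
      simp [hy, hk]
  have h2 := h y
  simp only [hsum, ← Complex.ofReal_sum, Complex.zero_le_real] at h2
  simp [Fin.sum_univ_three, a, commutatorCoeff_momentX_zero] at h2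
  linarith

/-- If `200/297 < x ≤ 667/990` then `W_{α(x)}` is quartically hyponormal but not
`3`-hyponormal. -/
theorem quartically_hyponormal_not_threeHyponormal (x : ℝ)
    (hx : 200 / 297 < x) (hx' : x ≤ 667 / 990)
    (W : H →L[ℂ] H) (hW : IsWeightedShift (alphaX x) W) :
    WeaklyKHyponormal 4 W ∧ ¬ KHyponormal 3 W := by
  exact ⟨weaklyKHyponormal_four (by linarith) hx' hW, not_kHyponormal_three hx hW⟩
end
end
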